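/- Let Ω ⊂ ℝⁿ be an (ε,δ)-domain, λ := λ_{ε,δ}, and f ∈ bmo_λ(Ω). Then the following are equivalent: (i) there exists a sequence f_j converging to f in the ‖·‖_{bmo_λ(Ω)} norm with dist(supp f_j, ∂Ω) > 0 for each j; (ii) f vanishes at the boundary, i.e., lim_{t→0⁺} ‖f‖_{bmo_λ(Ω ∖ Ω̊_t)} = 0. -/

import Mathlib

open MeasureTheory Metric Filter Topology

noncomputable section

/-- A closed axis-parallel cube in ℝⁿ: a closed ball in the sup norm with
positive radius (`half` = half the sidelength). -/
structure Cube (n : ℕ) where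
  center : Fin n → ℝ
  half : ℝ
  half_pos : 0 < half

namespace Cube

variable {n : ℕ}

/-- The underlying set of a cube. -/
def toSet (Q : Cube n) : Set (Fin n → ℝ) := Metric.closedBall Q.center Q.half

/-- The sidelength ℓ(Q). -/
def side (Q : Cube n) : ℝ := 2 * Q.half

/-- The mean f_Q of f over Q. -/
def avg (Q : Cube n) (f : (Fin n → ℝ) → ℝ) : ℝ := ⨍ x in Q.toSet, f x

/-- Mean oscillation of f over Q. -/
def osc (Q : Cube n) (f : (Fin n → ℝ) → ℝ) : ℝ := ⨍ x in Q.toSet, |f x - Q.avg f|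

/-- The mean |f|_Q of |f| over Q. -/
def avgAbs (Q : Cube n) (f : (Fin n → ℝ) → ℝ) : ℝ := ⨍ x in Q.toSet, |f x|

/-- Distance from the cube to the origin. -/
def distToOrigin (Q : Cube n) : ℝ := Metric.infDist (0 : Fin n → ℝ) Q.toSet

/-- The cube 2Q, concentric with Q and of twice the sidelength. -/
def double (Q : Cube n) : Cube n := ⟨Q.center, 2 * Q.half, mul_pos two_pos Q.half_pos⟩

end Cube

variable {n : ℕ}

/-- The modulus of mean oscillation ω_U(f,t): the supremum of the mean oscillation
of f over cubes Q ⊆ U of sidelength < t. -/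
def omegaOn (U : Set (Fin n → ℝ)) (f : (Fin n → ℝ) → ℝ) (t : ℝ) : ℝ :=
  sSup {r | ∃ Q : Cube n, Q.toSet ⊆ U ∧ Q.side < t ∧ r = Q.osc f}

/-- sup{ |f|_Q : Q ⊆ U, ℓ(Q) ≥ lam }. -/
def bigAvgSup (U : Set (Fin n → ℝ)) (lam : ℝ) (f : (Fin n → ℝ) → ℝ) : ℝ :=
  sSup {r | ∃ Q : Cube n, Q.toSet ⊆ U ∧ lam ≤ Q.side ∧ r = Q.avgAbs f}

/-- The nonhomogeneous norm ‖f‖_{bmo_lam(U)}. -/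
def bmoNorm (U : Set (Fin n → ℝ)) (lam : ℝ) (f : (Fin n → ℝ) → ℝ) : ℝ :=
  omegaOn U f lam + bigAvgSup U lam f

/-- Membership in bmo_lam(U): integrable on every cube in U and finite norm. -/
def MemBmo (U : Set (Fin n → ℝ)) (lam : ℝ) (f : (Fin n → ℝ) → ℝ) : Prop :=
  (∀ Q : Cube n, Q.toSet ⊆ U → IntegrableOn f Q.toSet) ∧
  BddAbove {r | ∃ Q : Cube n, Q.toSet ⊆ U ∧ Q.side < lam ∧ r = Q.osc f} ∧
  BddAbove {r | ∃ Q : Cube n, Q.toSet ⊆ U ∧ lam ≤ Q.side ∧ r = Q.avgAbs f}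

/-- Sarason's vanishing mean oscillation condition: ω_U(f,t) → 0 as t → 0⁺. -/
def VanishSmallOsc (U : Set (Fin n → ℝ)) (f : (Fin n → ℝ) → ℝ) : Prop :=
  Tendsto (fun t => omegaOn U f t) (nhdsWithin 0 (Set.Ioi 0)) (nhds 0)

/-- f is bounded on U. -/
def BoundedOn (U : Set (Fin n → ℝ)) (f : (Fin n → ℝ) → ℝ) : Prop :=
  ∃ M : ℝ, ∀ x ∈ U, |f x| ≤ M

/-- f is Lipschitz on U. -/
def LipschitzOn (U : Set (Fin n → ℝ)) (f : (Fin n → ℝ) → ℝ) : Prop :=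
  ∃ K : NNReal, LipschitzOnWith K f U

/-- dist(supp f, ∂U) > 0. -/
def SuppAway (U : Set (Fin n → ℝ)) (f : (Fin n → ℝ) → ℝ) : Prop :=
  ∃ d > 0, ∀ x ∈ Function.support f, ∀ y ∈ frontier U, d ≤ dist x y

/-- The nonhomogeneous Lipschitz norm ‖f‖_{Lip_b(U)} = ‖f‖_∞ + Lipschitz seminorm. -/
def lipbNorm (U : Set (Fin n → ℝ)) (f : (Fin n → ℝ) → ℝ) : ℝ :=
  sSup {r | ∃ x ∈ U, r = |f x|} +
  sSup {r | ∃ x ∈ U, ∃ y ∈ U, x ≠ y ∧ r = |f x - f y| / dist x y}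

/-- U is a domain: a nonempty open connected subset of ℝⁿ. -/
def IsRealDomain (U : Set (Fin n → ℝ)) : Prop := IsOpen U ∧ IsConnected U

/-- U is an (ε,δ)-domain. -/
def IsEpsDeltaDomain (U : Set (Fin n → ℝ)) (ε δ : ℝ) : Prop :=
  ∀ x ∈ U, ∀ y ∈ U, dist x y < δ →
    ∃ γ : ℝ → (Fin n → ℝ), ContinuousOn γ (Set.Icc 0 1) ∧ γ 0 = x ∧ γ 1 = y ∧
      (∀ t ∈ Set.Icc (0:ℝ) 1, γ t ∈ U) ∧
      eVariationOn γ (Set.Icc 0 1) ≤ ENNReal.ofReal (ε⁻¹ * dist x y) ∧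
      ∀ t ∈ Set.Icc (0:ℝ) 1,
        ε * (dist (γ t) x * dist (γ t) y) / dist x y ≤ Metric.infDist (γ t) (frontier U)

/-- The natural scale λ_{ε,δ} for an (ε,δ)-domain. -/
def lamED (n : ℕ) (ε δ : ℝ) : ℝ := ε ^ 2 * δ / (320 * n * (1 + Real.sqrt n * ε))

/-- d_Ω(x) = dist(x,∂Ω). -/
def distBd (U : Set (Fin n → ℝ)) (x : Fin n → ℝ) : ℝ := Metric.infDist x (frontier U)

/-- Ω̊_t = {x ∈ Ω : d_Ω(x) ≥ t}. -/
def innerPart (U : Set (Fin n → ℝ)) (t : ℝ) : Set (Fin n → ℝ) :=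
  {x ∈ U | t ≤ distBd U x}

/-- f vanishes at infinity in the bmo_lam(U) sense. -/
def VanishAtInfinity (U : Set (Fin n → ℝ)) (lam : ℝ) (f : (Fin n → ℝ) → ℝ) : Prop :=
  Tendsto (fun R => bmoNorm (U \ Metric.closedBall 0 R) lam f) atTop (nhds 0)

/-- f vanishes at the boundary in the bmo_lam(U) sense. -/
def VanishAtBoundary (U : Set (Fin n → ℝ)) (lam : ℝ) (f : (Fin n → ℝ) → ℝ) : Prop :=
  Tendsto (fun t => bmoNorm (U \ innerPart U t) lam f) (nhdsWithin 0 (Set.Ioi 0)) (nhds 0)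

/-- f is in the bmo_lam(U)-closure of the continuous functions with compact support in U. -/
def InCmoClosure (U : Set (Fin n → ℝ)) (lam : ℝ) (f : (Fin n → ℝ) → ℝ) : Prop :=
  ∃ g : ℕ → (Fin n → ℝ) → ℝ,
    (∀ j, Continuous (g j) ∧ HasCompactSupport (g j) ∧ tsupport (g j) ⊆ U) ∧
    Tendsto (fun j => bmoNorm U lam (f - g j)) atTop (nhds 0)

/-- The homogeneous BMO(ℝⁿ) seminorm: sup of mean oscillation over all cubes. -/
def bmoHNorm (f : (Fin n → ℝ) → ℝ) : ℝ := sSup {r | ∃ Q : Cube n, r = Q.osc f}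

namespace Cube

lemma measurableSet_toSet (Q : Cube n) : MeasurableSet Q.toSet := measurableSet_closedBall

lemma isCompact_toSet (Q : Cube n) : IsCompact Q.toSet := isCompact_closedBall _ _

lemma volume_toSet (Q : Cube n) : volume Q.toSet = ENNReal.ofReal ((2 * Q.half) ^ n) := by
  simp [toSet, Real.volume_pi_closedBall _ Q.half_pos.le]

lemma real_volume_toSet (Q : Cube n) : volume.real Q.toSet = (2 * Q.half) ^ n := by
  have := Q.half_pos
  rw [Measure.real, volume_toSet, ENNReal.toReal_ofReal (by positivity)]

lemma real_volume_pos (Q : Cube n) : 0 < volume.real Q.toSet := by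
  have := Q.half_pos
  rw [real_volume_toSet]; positivity

lemma volume_ne_zero (Q : Cube n) : volume Q.toSet ≠ 0 := by
  have := Q.half_pos
  rw [volume_toSet]
  have : 0 < (2 * Q.half) ^ n := by positivity
  simpa using this

lemma volume_ne_top (Q : Cube n) : volume Q.toSet ≠ ⊤ := by
  rw [volume_toSet]; exact ENNReal.ofReal_ne_top

lemma avg_eq (Q : Cube n) (f : (Fin n → ℝ) → ℝ) :
    Q.avg f = (volume.real Q.toSet)⁻¹ * ∫ x in Q.toSet, f x := by
  rw [avg, setAverage_eq, smul_eq_mul]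

lemma osc_eq (Q : Cube n) (f : (Fin n → ℝ) → ℝ) :
    Q.osc f = Q.avg (fun x => |f x - Q.avg f|) := rfl

lemma avgAbs_eq (Q : Cube n) (f : (Fin n → ℝ) → ℝ) : Q.avgAbs f = Q.avg (fun x => |f x|) := rfl

lemma integrableOn_const' (Q : Cube n) (c : ℝ) : IntegrableOn (fun _ => c) Q.toSet :=
  integrableOn_const Q.volume_ne_top

lemma avg_const (Q : Cube n) (c : ℝ) : Q.avg (fun _ => c) = c :=
  setAverage_const Q.volume_ne_zero Q.volume_ne_top c

lemma avg_mono {Q : Cube n} {f g : (Fin n → ℝ) → ℝ} (hf : IntegrableOn f Q.toSet)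
    (hg : IntegrableOn g Q.toSet) (h : ∀ x ∈ Q.toSet, f x ≤ g x) : Q.avg f ≤ Q.avg g := by
  rw [avg_eq, avg_eq]
  exact mul_le_mul_of_nonneg_left (setIntegral_mono_on hf hg Q.measurableSet_toSet h)
    (inv_nonneg.2 Q.real_volume_pos.le)

lemma avg_congr {Q : Cube n} {f g : (Fin n → ℝ) → ℝ} (h : ∀ x ∈ Q.toSet, f x = g x) :
    Q.avg f = Q.avg g := by
  rw [avg_eq, avg_eq, setIntegral_congr_fun Q.measurableSet_toSet h]

lemma avg_add {Q : Cube n} {f g : (Fin n → ℝ) → ℝ} (hf : IntegrableOn f Q.toSet)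
    (hg : IntegrableOn g Q.toSet) : Q.avg (fun x => f x + g x) = Q.avg f + Q.avg g := by
  simp only [avg_eq]
  rw [integral_add hf hg, mul_add]

lemma avg_sub {Q : Cube n} {f g : (Fin n → ℝ) → ℝ} (hf : IntegrableOn f Q.toSet)
    (hg : IntegrableOn g Q.toSet) : Q.avg (fun x => f x - g x) = Q.avg f - Q.avg g := by
  simp only [avg_eq]
  rw [integral_sub hf hg, mul_sub]

lemma avg_const_mul (Q : Cube n) (c : ℝ) (f : (Fin n → ℝ) → ℝ) :
    Q.avg (fun x => c * f x) = c * Q.avg f := by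
  simp only [avg_eq]
  rw [integral_const_mul]; ring

lemma avg_nonneg {Q : Cube n} {f : (Fin n → ℝ) → ℝ} (h : ∀ x ∈ Q.toSet, 0 ≤ f x) :
    0 ≤ Q.avg f := by
  rw [avg_eq]
  exact mul_nonneg (inv_nonneg.2 Q.real_volume_pos.le)
    (setIntegral_nonneg Q.measurableSet_toSet h)

lemma osc_nonneg (Q : Cube n) (f : (Fin n → ℝ) → ℝ) : 0 ≤ Q.osc f :=
  avg_nonneg fun _ _ => abs_nonneg _

lemma avgAbs_nonneg (Q : Cube n) (f : (Fin n → ℝ) → ℝ) : 0 ≤ Q.avgAbs f :=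
  avg_nonneg fun _ _ => abs_nonneg _

lemma abs_avg_le (Q : Cube n) (f : (Fin n → ℝ) → ℝ) : |Q.avg f| ≤ Q.avgAbs f := by
  rw [avgAbs_eq, avg_eq, avg_eq, abs_mul, abs_of_nonneg (inv_nonneg.2 Q.real_volume_pos.le)]
  exact mul_le_mul_of_nonneg_left (abs_integral_le_integral_abs)
    (inv_nonneg.2 Q.real_volume_pos.le)

lemma integrableOn_abs_sub {Q : Cube n} {f : (Fin n → ℝ) → ℝ} (hf : IntegrableOn f Q.toSet)
    (c : ℝ) : IntegrableOn (fun x => |f x - c|) Q.toSet :=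
  (hf.sub (Q.integrableOn_const' c)).abs

lemma abs_avg_sub_le {Q : Cube n} {f : (Fin n → ℝ) → ℝ} (hf : IntegrableOn f Q.toSet)
    (c : ℝ) : |Q.avg f - c| ≤ Q.avg (fun x => |f x - c|) := by
  have h := abs_avg_le Q (fun x => f x - c)
  rwa [avg_sub hf (Q.integrableOn_const' c), avg_const] at h

lemma osc_le_two_mul {Q : Cube n} {f : (Fin n → ℝ) → ℝ} (hf : IntegrableOn f Q.toSet)
    (c : ℝ) : Q.osc f ≤ 2 * Q.avg (fun x => |f x - c|) := by
  have h1 := abs_avg_sub_le hf c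
  have h2 : Q.osc f ≤ Q.avg (fun x => |f x - c| + |Q.avg f - c|) :=
    avg_mono (integrableOn_abs_sub hf _)
      ((integrableOn_abs_sub hf _).add (Q.integrableOn_const' _)) fun x _ => by
        have := abs_sub_le (f x) c (Q.avg f)
        rwa [abs_sub_comm c] at this
  rw [avg_add (integrableOn_abs_sub hf _) (Q.integrableOn_const' _), avg_const] at h2
  linarith

lemma osc_le_two_mul_avgAbs {Q : Cube n} {f : (Fin n → ℝ) → ℝ} (hf : IntegrableOn f Q.toSet) :
    Q.osc f ≤ 2 * Q.avgAbs f := by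
  simpa [avgAbs_eq] using osc_le_two_mul hf 0

lemma osc_congr {Q : Cube n} {f g : (Fin n → ℝ) → ℝ} (h : ∀ x ∈ Q.toSet, f x = g x) :
    Q.osc f = Q.osc g := by
  rw [osc_eq, osc_eq, avg_congr h]
  exact avg_congr fun x hx => by rw [h x hx]

lemma avgAbs_congr {Q : Cube n} {f g : (Fin n → ℝ) → ℝ} (h : ∀ x ∈ Q.toSet, f x = g x) :
    Q.avgAbs f = Q.avgAbs g :=
  avg_congr fun x hx => by rw [h x hx]

lemma osc_sub_le {Q : Cube n} {f g : (Fin n → ℝ) → ℝ} (hf : IntegrableOn f Q.toSet)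
    (hg : IntegrableOn g Q.toSet) : Q.osc (f - g) ≤ Q.osc f + Q.osc g := by
  have h1 : Q.avg (f - g) = Q.avg f - Q.avg g := avg_sub hf hg
  rw [osc_eq, osc_eq, osc_eq, h1,
    ← avg_add (integrableOn_abs_sub hf _) (integrableOn_abs_sub hg _)]
  refine avg_mono (integrableOn_abs_sub (hf.sub hg) _)
    ((integrableOn_abs_sub hf _).add (integrableOn_abs_sub hg _)) fun x _ => ?_
  have : (f - g) x - (Q.avg f - Q.avg g) = (f x - Q.avg f) - (g x - Q.avg g) := by
    simp only [Pi.sub_apply]; ring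
  rw [this]
  exact abs_sub _ _

lemma avgAbs_sub_le {Q : Cube n} {f g : (Fin n → ℝ) → ℝ} (hf : IntegrableOn f Q.toSet)
    (hg : IntegrableOn g Q.toSet) : Q.avgAbs (f - g) ≤ Q.avgAbs f + Q.avgAbs g := by
  rw [avgAbs_eq, avgAbs_eq, avgAbs_eq, ← avg_add hf.abs hg.abs]
  exact avg_mono (hf.sub hg).abs (hf.abs.add hg.abs) fun x _ => abs_sub _ _

/-- Enlarging the cube costs at most the ratio of the volumes. -/
lemma avg_le_of_subset {P Q : Cube n} (h : P.toSet ⊆ Q.toSet) {f : (Fin n → ℝ) → ℝ}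
    (hf : IntegrableOn f Q.toSet) (h0 : ∀ x ∈ Q.toSet, 0 ≤ f x) :
    P.avg f ≤ (Q.half / P.half) ^ n * Q.avg f := by
  have h1 : ∫ x in P.toSet, f x ≤ ∫ x in Q.toSet, f x :=
    setIntegral_mono_set hf ((ae_restrict_iff' Q.measurableSet_toSet).2 (.of_forall h0))
      h.eventuallyLE
  have hP := P.half_pos
  have hQ := Q.half_pos
  rw [avg_eq, avg_eq, real_volume_toSet, real_volume_toSet]
  calc ((2 * P.half) ^ n)⁻¹ * ∫ x in P.toSet, f x
      ≤ ((2 * P.half) ^ n)⁻¹ * ∫ x in Q.toSet, f x :=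
        mul_le_mul_of_nonneg_left h1 (by positivity)
    _ = _ := by rw [mul_pow, mul_pow, div_pow]; field_simp

lemma abs_avg_sub_avg_le {P Q : Cube n} (h : P.toSet ⊆ Q.toSet) {f : (Fin n → ℝ) → ℝ}
    (hf : IntegrableOn f Q.toSet) :
    |P.avg f - Q.avg f| ≤ (Q.half / P.half) ^ n * Q.osc f :=
  (abs_avg_sub_le (hf.mono_set h) _).trans
    (avg_le_of_subset h (integrableOn_abs_sub hf _) fun _ _ => abs_nonneg _)

lemma toSet_mk_mono {c : Fin n → ℝ} {h k : ℝ} (h0 : 0 < h) (hk : h ≤ k) :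
    (⟨c, h, h0⟩ : Cube n).toSet ⊆ (⟨c, k, h0.trans_le hk⟩ : Cube n).toSet :=
  closedBall_subset_closedBall hk

/-- Means over concentric cubes whose sizes differ by a factor at most `2 ^ k` differ by at most
`k * 2 ^ n` times a bound for the mean oscillations. -/
lemma abs_avg_sub_avg_concentric_le {f : (Fin n → ℝ) → ℝ} {c : Fin n → ℝ} {ρ η : ℝ} (hρ : 0 < ρ)
    (hf : IntegrableOn f (⟨c, ρ, hρ⟩ : Cube n).toSet)
    (hη : ∀ s (hs : 0 < s), s ≤ ρ → (⟨c, s, hs⟩ : Cube n).osc f ≤ η) (k : ℕ) :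
    ∀ h (h0 : 0 < h), h ≤ ρ → ρ ≤ 2 ^ k * h →
      |(⟨c, h, h0⟩ : Cube n).avg f - (⟨c, ρ, hρ⟩ : Cube n).avg f| ≤ k * (2 ^ n * η) := by
  have hη0 : 0 ≤ η := (osc_nonneg _ f).trans (hη ρ hρ le_rfl)
  induction k with
  | zero =>
    intro h h0 h1 h2
    obtain rfl : h = ρ := le_antisymm h1 (by simpa using h2)
    simp
  | succ k ih =>
    intro h h0 h1 h2
    have hm0 : 0 < min (2 * h) ρ := lt_min (by positivity) hρ
    have hm : h ≤ min (2 * h) ρ := le_min (by linarith) h1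
    have ih' := ih (min (2 * h) ρ) hm0 (min_le_right _ _) (by
      rw [mul_min_of_nonneg _ _ (by positivity)]
      refine le_min ?_ (le_mul_of_one_le_left hρ.le (one_le_pow₀ one_le_two))
      rw [pow_succ] at h2; linarith)
    have step := abs_avg_sub_avg_le (f := f) (toSet_mk_mono (c := c) h0 hm)
      (hf.mono_set (toSet_mk_mono hm0 (min_le_right _ _)))
    have hratio : (min (2 * h) ρ / h) ^ n ≤ 2 ^ n := by
      refine pow_le_pow_left₀ (by positivity) ?_ n
      rw [div_le_iff₀ h0]; exact min_le_left _ _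
    have step' := step.trans (mul_le_mul hratio (hη _ hm0 (min_le_right _ _)) (osc_nonneg _ f)
      (by positivity))
    push_cast
    have := abs_sub_le ((⟨c, h, h0⟩ : Cube n).avg f) ((⟨c, _, hm0⟩ : Cube n).avg f)
      ((⟨c, ρ, hρ⟩ : Cube n).avg f)
    linarith

/-- The centre of the subcube of index `i` when `Q` is divided into `m ^ n` equal cubes. -/
def subcube (Q : Cube n) (m : ℕ) (hm : 0 < m) (i : Fin n → Fin m) : Cube n where
  center := fun j => Q.center j - Q.half + (2 * (i j : ℝ) + 1) * (Q.half / m)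
  half := Q.half / m
  half_pos := div_pos Q.half_pos (by exact_mod_cast hm)

lemma subcube_subset (Q : Cube n) (m : ℕ) (hm : 0 < m) (i : Fin n → Fin m) :
    (Q.subcube m hm i).toSet ⊆ Q.toSet := by
  intro x hx
  have hQ := Q.half_pos
  have hm' : (0 : ℝ) < m := by exact_mod_cast hm
  rw [toSet, mem_closedBall, dist_pi_le_iff (Q.subcube m hm i).half_pos.le] at hx
  rw [toSet, mem_closedBall, dist_pi_le_iff hQ.le]
  intro j
  have h := hx j
  have hi : ((i j : ℕ) : ℝ) + 1 ≤ m := by exact_mod_cast (i j).2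
  have hw : 0 < Q.half / m := by positivity
  have hwm : m * (Q.half / m) = Q.half := by field_simp
  simp only [subcube, Real.dist_eq, abs_le] at h ⊢
  set w := Q.half / m
  have h0 : (0 : ℝ) ≤ (i j : ℕ) := Nat.cast_nonneg _
  constructor
  · nlinarith [h.1]
  · nlinarith [h.2]

lemma subset_iUnion_subcube (Q : Cube n) (m : ℕ) (hm : 0 < m) :
    Q.toSet ⊆ ⋃ i, (Q.subcube m hm i).toSet := by
  intro x hx
  have hQ := Q.half_pos
  have hm' : (0 : ℝ) < m := by exact_mod_cast hm
  have hw : 0 < Q.half / m := by positivity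
  have hwm : m * (Q.half / m) = Q.half := by field_simp
  rw [toSet, mem_closedBall, dist_pi_le_iff hQ.le] at hx
  have key : ∀ j, ∃ k : Fin m,
      |x j - (Q.center j - Q.half + (2 * (k : ℝ) + 1) * (Q.half / m))| ≤ Q.half / m := by
    intro j
    have h := hx j
    rw [Real.dist_eq, abs_le] at h
    set w := Q.half / m
    have hy : 0 ≤ (x j - Q.center j + Q.half) / (2 * w) := div_nonneg (by linarith) (by linarith)
    have hy2 : (x j - Q.center j + Q.half) / (2 * w) ≤ m := by
      rw [div_le_iff₀ (by positivity)]; nlinarith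
    have hxy : x j = (x j - Q.center j + Q.half) / (2 * w) * (2 * w) + Q.center j - Q.half := by
      field_simp; ring
    set y := (x j - Q.center j + Q.half) / (2 * w)
    by_cases hlt : ⌊y⌋₊ < m
    · refine ⟨⟨_, hlt⟩, ?_⟩
      have h1 := Nat.floor_le hy
      have h2 := Nat.lt_floor_add_one y
      rw [hxy, abs_le]
      simp only
      constructor <;> nlinarith
    · refine ⟨⟨m - 1, by omega⟩, ?_⟩
      have h1 : (m : ℝ) ≤ y := (Nat.le_floor_iff hy).1 (not_lt.1 hlt)
      have h2 : y = m := le_antisymm hy2 h1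
      have h3 : ((m - 1 : ℕ) : ℝ) = m - 1 := by push_cast [Nat.cast_sub (by omega : 1 ≤ m)]; ring
      rw [hxy, h2, abs_le]
      simp only [h3]
      constructor <;> nlinarith
  choose k hk using key
  refine Set.mem_iUnion.2 ⟨k, ?_⟩
  rw [toSet, mem_closedBall, dist_pi_le_iff (Q.subcube m hm k).half_pos.le]
  intro j
  simpa [subcube, Real.dist_eq] using hk j

/-- A bound for the mean over all cubes of a subdivision is a bound for the mean. -/
lemma avg_le_of_subcube {Q : Cube n} {m : ℕ} (hm : 0 < m) {f : (Fin n → ℝ) → ℝ} {C : ℝ}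
    (hf : IntegrableOn f Q.toSet) (h0 : ∀ x ∈ Q.toSet, 0 ≤ f x)
    (h : ∀ i, (Q.subcube m hm i).avg f ≤ C) : Q.avg f ≤ C := by
  have hQ := Q.half_pos
  have hm' : (0 : ℝ) < m := by exact_mod_cast hm
  have hU : (⋃ i, (Q.subcube m hm i).toSet) = Q.toSet :=
    (Set.iUnion_subset fun i => Q.subcube_subset m hm i).antisymm (Q.subset_iUnion_subcube m hm)
  have hint : ∀ i, ∫ x in (Q.subcube m hm i).toSet, f x ≤ (2 * (Q.half / m)) ^ n * C := by
    intro i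
    have h1 := h i
    rw [avg_eq, inv_mul_le_iff₀ (real_volume_pos _), real_volume_toSet] at h1
    exact h1
  have hsum : ∫ x in Q.toSet, f x ≤ ∑ i, ∫ x in (Q.subcube m hm i).toSet, f x := by
    have hle : volume.restrict Q.toSet ≤
        ∑ i, volume.restrict (Q.subcube m hm i).toSet := by
      rw [← hU, ← Measure.sum_fintype]
      exact Measure.restrict_iUnion_le
    rw [← integral_finsetSum_measure fun i _ => hf.mono_set (Q.subcube_subset m hm i)]
    refine integral_mono_measure hle ?_ ?_
    · rw [Filter.EventuallyLE, ← Measure.sum_fintype, Measure.ae_sum_iff]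
      exact fun i => (ae_restrict_iff' (measurableSet_toSet _)).2
        (.of_forall fun x hx => h0 x (Q.subcube_subset m hm i hx))
    · exact integrable_finsetSum_measure.2 fun i _ => hf.mono_set (Q.subcube_subset m hm i)
  have htot := hsum.trans (Finset.sum_le_sum fun i _ => hint i)
  rw [Finset.sum_const, Finset.card_univ, Fintype.card_fun, Fintype.card_fin, Fintype.card_fin,
    nsmul_eq_mul] at htot
  rw [avg_eq, inv_mul_le_iff₀ Q.real_volume_pos, real_volume_toSet]
  refine htot.trans (le_of_eq ?_)
  push_cast
  rw [← mul_assoc, ← mul_pow]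
  congr 2
  field_simp

end Cube

lemma integral_neg_log_one_sub_div_le {h d : ℝ} (h0 : 0 ≤ h) (hd : h < d) :
    ∫ y in (0 : ℝ)..h, -Real.log (1 - y / d) ≤ d := by
  have hd0 : 0 < d := h0.trans_lt hd
  rw [intervalIntegral.integral_neg,
    intervalIntegral.integral_comp_sub_div (fun y => Real.log y) hd0.ne' 1, integral_log]
  have h1 : 0 ≤ h / d := by positivity
  have h2 : h / d < 1 := (div_lt_one hd0).2 hd
  have h3 : (1 - h / d) * Real.log (1 - h / d) ≤ 0 :=
    mul_nonpos_of_nonneg_of_nonpos (by linarith) (Real.log_nonpos (by linarith) (by linarith))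
  simp only [zero_div, sub_zero, Real.log_one, mul_zero, smul_eq_mul]
  nlinarith

lemma continuousOn_neg_log_one_sub_div {h d : ℝ} (h0 : 0 ≤ h) (hd : h < d) :
    ContinuousOn (fun y : ℝ => -Real.log (1 - y / d)) (Set.Icc 0 h) := by
  have hd0 : 0 < d := h0.trans_lt hd
  refine ContinuousOn.neg (ContinuousOn.log (by fun_prop) fun y hy => ?_)
  have : y / d < 1 := (div_lt_one hd0).2 (hy.2.trans_lt hd)
  linarith

lemma Cube.avg_neg_log_one_sub_dist_div_le (hn : 0 < n) (Q : Cube n) {d : ℝ} (hd : Q.half < d) :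
    Q.avg (fun x => -Real.log (1 - dist x Q.center / d)) ≤ n * (d / Q.half) := by
  have hh := Q.half_pos
  have hd0 : 0 < d := hh.trans hd
  have : Nonempty (Fin n) := ⟨⟨0, hn⟩⟩
  set G : ℝ → ℝ := fun y => -Real.log (1 - y / d) with hG
  set F : ℝ → ℝ := (Set.Iic Q.half).indicator G with hF
  have hcont := continuousOn_neg_log_one_sub_div hh.le hd
  have e1 : ∫ x in Q.toSet, -Real.log (1 - dist x Q.center / d) = ∫ x, F ‖x - Q.center‖ := by
    rw [← integral_indicator Q.measurableSet_toSet]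
    simp only [hF, hG, Set.indicator, Cube.toSet, mem_closedBall, Set.mem_Iic, dist_eq_norm]
  have e2 : ∫ x : Fin n → ℝ, F ‖x - Q.center‖ = ∫ x : Fin n → ℝ, F ‖x‖ :=
    integral_sub_right_eq_self (fun x => F ‖x‖) Q.center
  have e3 : ∫ y in Set.Ioi (0 : ℝ), y ^ (n - 1) • F y
      = ∫ y in (0 : ℝ)..Q.half, y ^ (n - 1) * G y := by
    rw [intervalIntegral.integral_of_le hh.le]
    have : (fun y : ℝ => y ^ (n - 1) • F y)
        = (Set.Iic Q.half).indicator (fun y => y ^ (n - 1) * G y) := by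
      ext y
      by_cases hy : y ≤ Q.half <;> simp [hF, Set.indicator, hy]
    rw [this, setIntegral_indicator measurableSet_Iic, Set.Ioi_inter_Iic]
  have e4 : ∫ y in (0 : ℝ)..Q.half, y ^ (n - 1) * G y
      ≤ ∫ y in (0 : ℝ)..Q.half, Q.half ^ (n - 1) * G y := by
    have hu : Set.uIcc 0 Q.half = Set.Icc 0 Q.half := Set.uIcc_of_le hh.le
    refine intervalIntegral.integral_mono_on hh.le ?_ ?_ fun y hy => ?_
    · apply ContinuousOn.intervalIntegrable
      rw [hu]
      exact (by fun_prop : ContinuousOn (fun y : ℝ => y ^ (n - 1)) _).mul hcont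
    · apply ContinuousOn.intervalIntegrable
      rw [hu]
      exact continuousOn_const.mul hcont
    · have h1 : y / d < 1 := (div_lt_one hd0).2 (hy.2.trans_lt hd)
      have h2 : 0 ≤ y / d := div_nonneg hy.1 hd0.le
      have h3 : Real.log (1 - y / d) ≤ 0 := Real.log_nonpos (by linarith) (by linarith)
      exact mul_le_mul_of_nonneg_right (pow_le_pow_left₀ hy.1 hy.2 _) (by simpa [hG] using h3)
  have e5 := integral_neg_log_one_sub_div_le hh.le hd
  have hball : volume.real (ball (0 : Fin n → ℝ) 1) = 2 ^ n := by
    rw [Measure.real, Real.volume_pi_ball _ one_pos, ENNReal.toReal_ofReal (by positivity)]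
    simp
  rw [Cube.avg_eq, e1, e2, integral_fun_norm_addHaar, Module.finrank_fin_fun, e3, hball,
    Cube.real_volume_toSet, inv_mul_le_iff₀ (by positivity), nsmul_eq_mul, smul_eq_mul]
  rw [intervalIntegral.integral_const_mul] at e4
  have e6 : ∫ y in (0 : ℝ)..Q.half, y ^ (n - 1) * G y ≤ Q.half ^ (n - 1) * d :=
    e4.trans (mul_le_mul_of_nonneg_left e5 (by positivity))
  calc (n : ℝ) * (2 ^ n * ∫ y in (0 : ℝ)..Q.half, y ^ (n - 1) * G y)
      ≤ n * (2 ^ n * (Q.half ^ (n - 1) * d)) := by gcongr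
    _ = (2 * Q.half) ^ n * (n * (d / Q.half)) := by
      obtain ⟨k, rfl⟩ := Nat.exists_eq_succ_of_ne_zero hn.ne'
      rw [mul_pow, Nat.succ_sub_one, pow_succ Q.half]
      field_simp

/-- On a cube contained in the ball of radius `D c` about its centre `c`, the logarithm of a
positive 1-Lipschitz function `D` has mean deviation from its value at `c` of the order of the
ratio of the size of the cube to `D c`. -/
lemma Cube.avg_abs_log_sub_log_le (hn : 0 < n) (Q : Cube n) {D : (Fin n → ℝ) → ℝ}
    (hD : ∀ x y, |D x - D y| ≤ dist x y) (hQ : Q.half < D Q.center) :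
    IntegrableOn (fun x => |Real.log (D x) - Real.log (D Q.center)|) Q.toSet ∧
    Q.avg (fun x => |Real.log (D x) - Real.log (D Q.center)|)
      ≤ (4 * n + 2) * (Q.half / D Q.center) := by
  have hh := Q.half_pos
  have hn' : (0 : ℝ) < n := by exact_mod_cast hn
  set d := D Q.center with hd
  have hd0 : 0 < d := hh.trans hQ
  have hDx : ∀ x ∈ Q.toSet, d - dist x Q.center ≤ D x ∧ D x ≤ d + dist x Q.center ∧
      dist x Q.center ≤ Q.half := fun x hx => by
    have h1 := abs_le.1 (hD x Q.center)
    exact ⟨by linarith [h1.1], by linarith [h1.2], hx⟩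
  have hDpos : ∀ x ∈ Q.toSet, 0 < D x := fun x hx => by
    have := hDx x hx
    linarith [this.1, this.2.2]
  have hDcont : Continuous D := by
    refine LipschitzWith.continuous (K := 1) (LipschitzWith.of_dist_le_mul fun x y => ?_)
    simpa [Real.dist_eq] using hD x y
  have hint : IntegrableOn (fun x => |Real.log (D x) - Real.log d|) Q.toSet := by
    refine ContinuousOn.integrableOn_compact Q.isCompact_toSet (ContinuousOn.abs ?_)
    exact (ContinuousOn.log hDcont.continuousOn fun x hx => (hDpos x hx).ne').sub continuousOn_const
  refine ⟨hint, ?_⟩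
  have hup : ∀ x ∈ Q.toSet, Real.log (D x) - Real.log d ≤ dist x Q.center / d := fun x hx => by
    rw [← Real.log_div (hDpos x hx).ne' hd0.ne']
    refine (Real.log_le_sub_one_of_pos (div_pos (hDpos x hx) hd0)).trans ?_
    rw [sub_le_iff_le_add, div_add_one hd0.ne']
    exact div_le_div_of_nonneg_right (by linarith [(hDx x hx).2.1]) hd0.le
  by_cases hcase : Q.half ≤ d / 2
  · have hb : ∀ x ∈ Q.toSet, |Real.log (D x) - Real.log d| ≤ 2 * (Q.half / d) := fun x hx => by
      obtain ⟨h1, h2, h3⟩ := hDx x hx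
      have h4 := hDpos x hx
      have h5 : 0 < Q.half / d := by positivity
      rw [abs_le]
      constructor
      · have : Real.log d - Real.log (D x) ≤ 2 * (Q.half / d) := by
          rw [← Real.log_div hd0.ne' h4.ne']
          refine (Real.log_le_sub_one_of_pos (div_pos hd0 h4)).trans ?_
          rw [sub_le_iff_le_add, div_le_iff₀ h4]
          have h6 : Q.half / d * D x ≥ Q.half / d * (d / 2) :=
            mul_le_mul_of_nonneg_left (by linarith) h5.le
          have h7 : Q.half / d * (d / 2) = Q.half / 2 := by field_simp
          nlinarith
        linarith
      · have h8 : dist x Q.center / d ≤ Q.half / d := div_le_div_of_nonneg_right h3 hd0.le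
        linarith [hup x hx]
    refine (avg_mono hint (Q.integrableOn_const' _) hb).trans ?_
    rw [avg_const]
    exact mul_le_mul_of_nonneg_right (by linarith) (by positivity)
  · push Not at hcase
    have hcont : ContinuousOn (fun x => -Real.log (1 - dist x Q.center / d)) Q.toSet :=
      (continuousOn_neg_log_one_sub_div hh.le hQ).comp
        (f := fun x => dist x Q.center) (by fun_prop) fun x hx => ⟨dist_nonneg, hx⟩
    have hint2 := hcont.integrableOn_compact (μ := volume) Q.isCompact_toSet
    have hb : ∀ x ∈ Q.toSet, |Real.log (D x) - Real.log d|
        ≤ 1 + -Real.log (1 - dist x Q.center / d) := fun x hx => by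
      obtain ⟨h1, h2, h3⟩ := hDx x hx
      have h4 := hDpos x hx
      have h5 : 0 < 1 - dist x Q.center / d := by
        rw [sub_pos, div_lt_one hd0]; linarith
      have h6 : Real.log (1 - dist x Q.center / d) ≤ 0 :=
        Real.log_nonpos h5.le (by linarith [div_nonneg (dist_nonneg (x := x) (y := Q.center)) hd0.le])
      rw [abs_le]
      constructor
      · have : Real.log d + Real.log (1 - dist x Q.center / d) ≤ Real.log (D x) := by
          rw [← Real.log_mul hd0.ne' h5.ne']
          refine Real.log_le_log (by positivity) ?_
          rw [mul_sub, mul_div_cancel₀ _ hd0.ne', mul_one]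
          exact h1
        linarith
      · linarith [hup x hx]
    have h0 := avg_mono hint ((Q.integrableOn_const' 1).add hint2) hb
    have h0' := avg_add (Q.integrableOn_const' 1) hint2
    rw [avg_const] at h0'
    refine (h0.trans h0'.le).trans ?_
    have h1 := Q.avg_neg_log_one_sub_dist_div_le hn hQ
    have h2 : d / Q.half ≤ 2 := by rw [div_le_iff₀ hh]; linarith
    have h3 : 1 / 2 ≤ Q.half / d := by rw [le_div_iff₀ hd0]; linarith
    nlinarith

section BmoNorm

variable {U V : Set (Fin n → ℝ)} {lam : ℝ} {f g : (Fin n → ℝ) → ℝ}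

lemma MemBmo.osc_le_omegaOn (hf : MemBmo U lam f) {Q : Cube n} (hQ : Q.toSet ⊆ U)
    (hs : Q.side < lam) : Q.osc f ≤ omegaOn U f lam :=
  le_csSup hf.2.1 ⟨Q, hQ, hs, rfl⟩

lemma MemBmo.avgAbs_le_bigAvgSup (hf : MemBmo U lam f) {Q : Cube n} (hQ : Q.toSet ⊆ U)
    (hs : lam ≤ Q.side) : Q.avgAbs f ≤ bigAvgSup U lam f :=
  le_csSup hf.2.2 ⟨Q, hQ, hs, rfl⟩

lemma omegaOn_nonneg (U : Set (Fin n → ℝ)) (f : (Fin n → ℝ) → ℝ) (t : ℝ) : 0 ≤ omegaOn U f t :=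
  Real.sSup_nonneg (by rintro _ ⟨Q, -, -, rfl⟩; exact Q.osc_nonneg f)

lemma bigAvgSup_nonneg (U : Set (Fin n → ℝ)) (t : ℝ) (f : (Fin n → ℝ) → ℝ) :
    0 ≤ bigAvgSup U t f :=
  Real.sSup_nonneg (by rintro _ ⟨Q, -, -, rfl⟩; exact Q.avgAbs_nonneg f)

lemma bmoNorm_nonneg (U : Set (Fin n → ℝ)) (t : ℝ) (f : (Fin n → ℝ) → ℝ) : 0 ≤ bmoNorm U t f :=
  add_nonneg (omegaOn_nonneg _ _ _) (bigAvgSup_nonneg _ _ _)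

lemma bmoNorm_le {a b : ℝ} (ha : 0 ≤ a) (hb : 0 ≤ b)
    (h1 : ∀ Q : Cube n, Q.toSet ⊆ U → Q.side < lam → Q.osc f ≤ a)
    (h2 : ∀ Q : Cube n, Q.toSet ⊆ U → lam ≤ Q.side → Q.avgAbs f ≤ b) :
    bmoNorm U lam f ≤ a + b :=
  add_le_add (Real.sSup_le (by rintro _ ⟨Q, hQ, hs, rfl⟩; exact h1 Q hQ hs) ha)
    (Real.sSup_le (by rintro _ ⟨Q, hQ, hs, rfl⟩; exact h2 Q hQ hs) hb)

lemma MemBmo.of_le {a b : ℝ} (hf : ∀ Q : Cube n, Q.toSet ⊆ U → IntegrableOn f Q.toSet)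
    (h1 : ∀ Q : Cube n, Q.toSet ⊆ U → Q.side < lam → Q.osc f ≤ a)
    (h2 : ∀ Q : Cube n, Q.toSet ⊆ U → lam ≤ Q.side → Q.avgAbs f ≤ b) : MemBmo U lam f :=
  ⟨hf, ⟨a, by rintro _ ⟨Q, hQ, hs, rfl⟩; exact h1 Q hQ hs⟩,
    ⟨b, by rintro _ ⟨Q, hQ, hs, rfl⟩; exact h2 Q hQ hs⟩⟩

lemma MemBmo.sub (hf : MemBmo U lam f) (hg : MemBmo U lam g) : MemBmo U lam (f - g) :=
  .of_le (fun Q hQ => (hf.1 Q hQ).sub (hg.1 Q hQ))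
    (fun Q hQ hs => (Cube.osc_sub_le (hf.1 Q hQ) (hg.1 Q hQ)).trans
      (add_le_add (hf.osc_le_omegaOn hQ hs) (hg.osc_le_omegaOn hQ hs)))
    (fun Q hQ hs => (Cube.avgAbs_sub_le (hf.1 Q hQ) (hg.1 Q hQ)).trans
      (add_le_add (hf.avgAbs_le_bigAvgSup hQ hs) (hg.avgAbs_le_bigAvgSup hQ hs)))

lemma MemBmo.congr (hf : MemBmo U lam f) (h : Set.EqOn f g U) : MemBmo U lam g :=
  .of_le (fun Q hQ => (hf.1 Q hQ).congr_fun (h.mono hQ) Q.measurableSet_toSet)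
    (fun _ hQ hs => (Cube.osc_congr (h.mono hQ)).symm.le.trans (hf.osc_le_omegaOn hQ hs))
    (fun _ hQ hs => (Cube.avgAbs_congr (h.mono hQ)).symm.le.trans (hf.avgAbs_le_bigAvgSup hQ hs))

lemma MemBmo.mono (hf : MemBmo U lam f) (h : V ⊆ U) : MemBmo V lam f :=
  .of_le (fun Q hQ => hf.1 Q (hQ.trans h))
    (fun _ hQ hs => hf.osc_le_omegaOn (hQ.trans h) hs)
    (fun _ hQ hs => hf.avgAbs_le_bigAvgSup (hQ.trans h) hs)

lemma bmoNorm_le_of_eqOn (hg : MemBmo U lam g) (hV : V ⊆ U) (h : Set.EqOn f g V) :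
    bmoNorm V lam f ≤ bmoNorm U lam g :=
  bmoNorm_le (omegaOn_nonneg _ _ _) (bigAvgSup_nonneg _ _ _)
    (fun _ hQ hs => (Cube.osc_congr (h.mono hQ)).le.trans (hg.osc_le_omegaOn (hQ.trans hV) hs))
    (fun _ hQ hs => (Cube.avgAbs_congr (h.mono hQ)).le.trans
      (hg.avgAbs_le_bigAvgSup (hQ.trans hV) hs))

lemma MemBmo.exists_osc_le (hf : MemBmo U lam f) :
    ∃ A, 0 ≤ A ∧ ∀ Q : Cube n, Q.toSet ⊆ U → Q.osc f ≤ A := by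
  have h1 := omegaOn_nonneg U f lam
  have h2 := bigAvgSup_nonneg U lam f
  refine ⟨omegaOn U f lam + 2 * bigAvgSup U lam f, by positivity, fun Q hQ => ?_⟩
  rcases lt_or_ge Q.side lam with hs | hs
  · linarith [hf.osc_le_omegaOn hQ hs]
  · linarith [hf.avgAbs_le_bigAvgSup hQ hs, Cube.osc_le_two_mul_avgAbs (hf.1 Q hQ)]

end BmoNorm

section DistBd

variable {Ω : Set (Fin n → ℝ)}

lemma abs_distBd_sub_le (Ω : Set (Fin n → ℝ)) (x y : Fin n → ℝ) :
    |distBd Ω x - distBd Ω y| ≤ dist x y := by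
  rw [abs_le]
  constructor
  · have := infDist_le_infDist_add_dist (x := y) (y := x) (s := frontier Ω)
    rw [dist_comm] at this
    unfold distBd; linarith
  · have := infDist_le_infDist_add_dist (x := x) (y := y) (s := frontier Ω)
    unfold distBd; linarith

lemma continuous_distBd (Ω : Set (Fin n → ℝ)) : Continuous (distBd Ω) :=
  continuous_infDist_pt _

lemma closedBall_subset_of_lt_distBd {x : Fin n → ℝ} {r : ℝ} (hx : x ∈ Ω) (hr0 : 0 ≤ r)
    (hr : r < distBd Ω x) : closedBall x r ⊆ Ω := by
  by_contra hsub
  obtain ⟨y, hy, hyΩ⟩ := Set.not_subset.1 hsub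
  have hpre : IsPreconnected (closedBall x r) := (convex_closedBall x r).isPreconnected
  obtain ⟨z, hz, hzf⟩ : (closedBall x r ∩ frontier Ω).Nonempty := by
    by_contra hempty
    have hnot : ∀ z ∈ closedBall x r, z ∉ frontier Ω := fun z hz hzf => hempty ⟨z, hz, hzf⟩
    have hcases : ∀ z ∈ closedBall x r, z ∈ interior Ω ∨ z ∈ (closure Ω)ᶜ := fun z hz => by
      by_contra! h
      exact hnot z hz ⟨not_not.1 h.2, h.1⟩
    have hxc := mem_closedBall_self (x := x) hr0
    obtain ⟨z, -, hz1, hz2⟩ := hpre _ _ isOpen_interior isClosed_closure.isOpen_compl hcases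
      ⟨x, hxc, (hcases x hxc).resolve_right fun h => h (subset_closure hx)⟩
      ⟨y, hy, (hcases y hy).resolve_left fun h => hyΩ (interior_subset h)⟩
    exact hz2 (subset_closure (interior_subset hz1))
  have h1 := infDist_le_dist_of_mem (x := x) hzf
  rw [mem_closedBall, dist_comm] at hz
  unfold distBd at hr
  linarith

lemma Cube.half_lt_distBd (hΩ : IsOpen Ω) (hfr : (frontier Ω).Nonempty) {Q : Cube n}
    (hQ : Q.toSet ⊆ Ω) : Q.half < distBd Ω Q.center := by
  obtain ⟨y, hy, hyd⟩ := isClosed_frontier.exists_infDist_eq_dist hfr Q.center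
  unfold distBd
  rw [hyd]
  by_contra hle
  push Not at hle
  have : y ∈ Ω := hQ (by rwa [Cube.toSet, mem_closedBall, dist_comm])
  rw [hΩ.frontier_eq] at hy
  exact hy.2 this

lemma Cube.center_mem (Q : Cube n) : Q.center ∈ Q.toSet := mem_closedBall_self Q.half_pos.le

lemma distBd_pos (hΩ : IsOpen Ω) (hfr : (frontier Ω).Nonempty) {x : Fin n → ℝ} (hx : x ∈ Ω) :
    0 < distBd Ω x := by
  refine (isClosed_frontier.notMem_iff_infDist_pos hfr).1 fun h => ?_
  rw [hΩ.frontier_eq] at h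
  exact h.2 hx

lemma IsEpsDeltaDomain.frontier_nonempty (hn : 0 < n) {ε δ : ℝ} (hε : 0 < ε) (hδ : 0 < δ)
    (hΩ : IsRealDomain Ω) (hed : IsEpsDeltaDomain Ω ε δ) : (frontier Ω).Nonempty := by
  by_contra hfr
  rw [Set.not_nonempty_iff_eq_empty] at hfr
  have : Nonempty (Fin n) := ⟨⟨0, hn⟩⟩
  obtain ⟨x, hx⟩ := hΩ.2.nonempty
  obtain ⟨r, hr, hball⟩ := Metric.isOpen_iff.1 hΩ.1 x hx
  set ρ := min r δ / 2 with hρ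
  have hm : 0 < min r δ := lt_min hr hδ
  have hρ0 : 0 < ρ := by positivity
  have hxy : dist x (x + (fun _ => ρ)) = ρ := by
    rw [dist_self_add_right, pi_norm_const, Real.norm_of_nonneg hρ0.le]
  set y := x + (fun _ : Fin n => ρ)
  have hy : y ∈ Ω := hball (by
    rw [mem_ball, dist_comm, hxy]; linarith [min_le_left r δ])
  obtain ⟨γ, hγ, h0, h1, -, -, hdist⟩ := hed x hx y hy (by rw [hxy]; linarith [min_le_right r δ])
  have hc : ContinuousOn (fun t => dist (γ t) x) (Set.Icc 0 1) :=
    (continuous_id.dist continuous_const).comp_continuousOn hγ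
  obtain ⟨t, ht, htd⟩ := intermediate_value_Icc zero_le_one hc
    (show ρ / 2 ∈ Set.Icc _ _ by
      rw [h0, h1, dist_self, dist_comm, hxy]; constructor <;> linarith)
  simp only at htd
  have h2 := hdist t ht
  rw [hfr, infDist_empty, htd, hxy] at h2
  have h3 := dist_triangle_left x y (γ t)
  rw [hxy, htd] at h3
  have h4 : 0 < dist (γ t) y := by linarith
  have : 0 < ε * (ρ / 2 * dist (γ t) y) / ρ := by positivity
  linarith

end DistBd

lemma vanishAtBoundary_of_approx {Ω : Set (Fin n → ℝ)} {lam : ℝ} {f : (Fin n → ℝ) → ℝ}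
    (hfr : (frontier Ω).Nonempty) (hf : MemBmo Ω lam f) {F : ℕ → (Fin n → ℝ) → ℝ}
    (hF : ∀ j, MemBmo Ω lam (F j) ∧ SuppAway Ω (F j))
    (hlim : Tendsto (fun j => bmoNorm Ω lam (f - F j)) atTop (nhds 0)) :
    VanishAtBoundary Ω lam f := by
  rw [VanishAtBoundary, Metric.tendsto_nhds]
  intro η hη
  obtain ⟨j, hj⟩ := ((Metric.tendsto_nhds.1 hlim) η hη).exists
  obtain ⟨d, hd, hsupp⟩ := (hF j).2
  filter_upwards [Ioo_mem_nhdsGT hd] with t ht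
  rw [Real.dist_0_eq_abs, abs_of_nonneg (bmoNorm_nonneg _ _ _)] at hj ⊢
  refine (bmoNorm_le_of_eqOn (hf.sub (hF j).1) Set.sdiff_subset fun x hx => ?_).trans_lt hj
  have hxt : infDist x (frontier Ω) < t := by
    by_contra hle
    exact hx.2 ⟨hx.1, not_lt.1 hle⟩
  obtain ⟨y, hy, hxy⟩ := (infDist_lt_iff hfr).1 hxt
  have : F j x = 0 := by
    by_contra hne
    linarith [hsupp x hne y hy, ht.2]
  simp [this]

/-- The mean of `f` over the cube centred at `x` of sidelength `dist(x, ∂Ω)`. -/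
def centerMean (Ω : Set (Fin n → ℝ)) (f : (Fin n → ℝ) → ℝ) (x : Fin n → ℝ) : ℝ :=
  ⨍ y in closedBall x (distBd Ω x / 2), f y

section CenterMean

variable {Ω : Set (Fin n → ℝ)} {f : (Fin n → ℝ) → ℝ}

lemma centerMean_eq_avg {x : Fin n → ℝ} (h : 0 < distBd Ω x / 2) :
    centerMean Ω f x = (⟨x, distBd Ω x / 2, h⟩ : Cube n).avg f := rfl

lemma abs_centerMean_sub_le (hf : ∀ Q : Cube n, Q.toSet ⊆ Ω → IntegrableOn f Q.toSet)
    {x y : Fin n → ℝ} (hx : x ∈ Ω) (hd : 0 < distBd Ω x) (hxy : dist x y ≤ distBd Ω x / 4) {η : ℝ}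
    (hη : (⟨x, 7 / 8 * distBd Ω x, by positivity⟩ : Cube n).osc f ≤ η) :
    |centerMean Ω f x - centerMean Ω f y| ≤ 2 * 3 ^ n * η := by
  have h1 := abs_le.1 (abs_distBd_sub_le Ω x y)
  set d := distBd Ω x with hdx
  have hy0 : 0 < distBd Ω y / 2 := by linarith [h1.2]
  set R : Cube n := ⟨x, 7 / 8 * d, by positivity⟩ with hR
  have hRΩ : R.toSet ⊆ Ω :=
    closedBall_subset_of_lt_distBd (r := 7 / 8 * d) hx (by positivity) (by linarith)
  have hint := hf R hRΩ
  have ho := Cube.osc_nonneg R f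
  have main : ∀ z (hz : 0 < distBd Ω z / 2), dist z x ≤ d / 4 → 3 / 4 * d ≤ distBd Ω z →
      distBd Ω z / 2 + dist z x ≤ 7 / 8 * d → |centerMean Ω f z - R.avg f| ≤ 3 ^ n * η := by
    intro z hz hzx h3 h4
    rw [centerMean_eq_avg hz]
    have hsub : (⟨z, distBd Ω z / 2, hz⟩ : Cube n).toSet ⊆ R.toSet :=
      closedBall_subset_closedBall' h4
    refine (Cube.abs_avg_sub_avg_le hsub hint).trans ?_
    have hr : (R.half / (distBd Ω z / 2)) ^ n ≤ 3 ^ n := by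
      refine pow_le_pow_left₀ (div_nonneg R.half_pos.le hz.le) ?_ n
      rw [div_le_iff₀ hz]
      simp only [hR]; linarith
    exact mul_le_mul hr hη ho (by positivity)
  have hx' := main x (by positivity) (by rw [dist_self]; positivity) (by linarith)
    (by rw [dist_self]; linarith)
  have hy' := main y hy0 (by rwa [dist_comm]) (by linarith [h1.2])
    (by rw [dist_comm y x]; linarith [h1.1])
  have := abs_sub_le (centerMean Ω f x) (R.avg f) (centerMean Ω f y)
  rw [abs_sub_comm (R.avg f)] at this
  linarith

end CenterMean

/-- A function of the parameter whose oscillation is at most `κ` over pieces of a curve of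
diameter at most `ρ` varies by at most `κ * (N + 1)` along a curve of length at most `N * ρ`. -/
lemma abs_sub_le_of_eVariationOn_le {E : Type*} [PseudoMetricSpace E] {γ : ℝ → E} {v : ℝ → ℝ}
    {ρ κ : ℝ} (hρ : 0 < ρ) (N : ℕ) :
    ∀ a b : ℝ, a ≤ b → ContinuousOn γ (Set.Icc a b) →
      (∀ s ∈ Set.Icc a b, ∀ t ∈ Set.Icc a b, dist (γ s) (γ t) ≤ ρ → |v s - v t| ≤ κ) →
      eVariationOn γ (Set.Icc a b) ≤ ENNReal.ofReal (N * ρ) → |v a - v b| ≤ κ * (N + 1) := by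
  induction N with
  | zero =>
    intro a b hab _ hv hvar
    have h1 := eVariationOn.edist_le γ (Set.left_mem_Icc.2 hab) (Set.right_mem_Icc.2 hab)
    have h2 : edist (γ a) (γ b) ≤ 0 := h1.trans (by simpa using hvar)
    have h3 : dist (γ a) (γ b) ≤ ρ := by
      rw [dist_edist, le_antisymm h2 bot_le]; simpa using hρ.le
    simpa using hv a (Set.left_mem_Icc.2 hab) b (Set.right_mem_Icc.2 hab) h3
  | succ N ih =>
    intro a b hab hγ hv hvar
    have ha := Set.left_mem_Icc.2 hab
    have hb := Set.right_mem_Icc.2 hab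
    have hκ : 0 ≤ κ := (abs_nonneg _).trans (hv a ha a ha (by simpa using hρ.le))
    push_cast
    by_cases hab' : dist (γ a) (γ b) ≤ ρ
    · have := hv a ha b hb hab'
      nlinarith [(Nat.cast_nonneg N : (0 : ℝ) ≤ N)]
    · push Not at hab'
      have hc : ContinuousOn (fun t => dist (γ a) (γ t)) (Set.Icc a b) :=
        (continuous_const.dist continuous_id).comp_continuousOn hγ
      obtain ⟨s, hs, hsd⟩ := intermediate_value_Icc hab hc
        (show ρ ∈ Set.Icc _ _ from ⟨by simpa using hρ.le, hab'.le⟩)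
      simp only at hsd
      have h1 : ENNReal.ofReal ρ ≤ eVariationOn γ (Set.Icc a s) := by
        have := eVariationOn.edist_le γ (Set.left_mem_Icc.2 hs.1) (Set.right_mem_Icc.2 hs.1)
        rwa [edist_dist, hsd] at this
      have h2 := eVariationOn.Icc_add_Icc γ (s := Set.univ) hs.1 hs.2 (Set.mem_univ _)
      simp only [Set.univ_inter] at h2
      have h3 : eVariationOn γ (Set.Icc s b) ≤ ENNReal.ofReal (N * ρ) := by
        have h4 : ENNReal.ofReal ρ + eVariationOn γ (Set.Icc s b)
            ≤ ENNReal.ofReal ρ + ENNReal.ofReal (N * ρ) := by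
          rw [← ENNReal.ofReal_add hρ.le (by positivity)]
          refine (add_le_add_left h1 _).trans (h2.le.trans (hvar.trans (le_of_eq ?_)))
          push_cast; ring_nf
        exact (ENNReal.add_le_add_iff_left ENNReal.ofReal_ne_top).1 h4
      have hsub : Set.Icc s b ⊆ Set.Icc a b := Set.Icc_subset_Icc_left hs.1
      have h5 := ih s b hs.2 (hγ.mono hsub)
        (fun p hp q hq => hv p (hsub hp) q (hsub hq)) h3
      have h6 := hv a ha s hs hsd.le
      have := abs_sub_le (v a) (v s) (v b)
      linarith

/-- The constant in the doubling step. -/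
def stepConst (n : ℕ) (ε : ℝ) : ℝ := 2 * 3 ^ n * (⌈128 / ε ^ 3⌉₊ + 1)

lemma stepConst_pos (n : ℕ) (ε : ℝ) : 0 < stepConst n ε := by unfold stepConst; positivity

section Doubling

variable {Ω : Set (Fin n → ℝ)} {f : (Fin n → ℝ) → ℝ} {ε δ : ℝ}

/-- Moving along the curves of an `(ε, δ)`-domain, one can double the distance to the boundary
at the cost of a bounded number of oscillations. -/
lemma IsEpsDeltaDomain.exists_double (hε : 0 < ε) (hε1 : ε ≤ 1)
    (hed : IsEpsDeltaDomain Ω ε δ) (hf : ∀ Q : Cube n, Q.toSet ⊆ Ω → IntegrableOn f Q.toSet)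
    {x y : Fin n → ℝ} (hx : x ∈ Ω) (hd : 0 < distBd Ω x) (hy : y ∈ Ω)
    (hxy : dist x y = 8 * distBd Ω x / ε) (hδ : dist x y < δ) {η : ℝ}
    (hη : ∀ Q : Cube n, Q.toSet ⊆ Ω → (∀ z ∈ Q.toSet, distBd Ω z < 10 * distBd Ω x / ε) →
      Q.osc f ≤ η) :
    ∃ z ∈ Ω, 2 * distBd Ω x ≤ distBd Ω z ∧
      |centerMean Ω f x - centerMean Ω f z| ≤ stepConst n ε * η := by
  obtain ⟨γ, hγ, h0, h1, hγΩ, hlen, hdist⟩ := hed x hx y hy hδ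
  set d := distBd Ω x with hdx
  set D := dist x y with hD
  have hD0 : 0 < D := by rw [hxy]; positivity
  have hDε : D * ε = 8 * d := by rw [hxy]; field_simp
  have hDd : 8 * d ≤ D := by nlinarith
  have hdε : d ≤ d / ε := by rw [le_div_iff₀ hε]; nlinarith
  have hc : ContinuousOn (fun t => dist (γ t) x) (Set.Icc 0 1) :=
    (continuous_id.dist continuous_const).comp_continuousOn hγ
  obtain ⟨τ, ⟨hτ, hτd⟩, hmin⟩ : ∃ τ, IsLeast {t ∈ Set.Icc (0 : ℝ) 1 | dist (γ t) x = D / 2} τ := by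
    refine IsCompact.exists_isLeast ?_ ?_
    · exact isCompact_Icc.of_isClosed_subset
        (hc.preimage_isClosed_of_isClosed isClosed_Icc isClosed_singleton) fun t ht => ht.1
    · obtain ⟨t, ht, htd⟩ := intermediate_value_Icc zero_le_one hc
        (show D / 2 ∈ Set.Icc _ _ by
          rw [h0, h1, dist_self, dist_comm y x, ← hD]; constructor <;> linarith)
      exact ⟨t, ht, htd⟩
  have hsub : Set.Icc 0 τ ⊆ Set.Icc (0 : ℝ) 1 := Set.Icc_subset_Icc_right hτ.2
  have hle : ∀ s ∈ Set.Icc (0 : ℝ) τ, dist (γ s) x ≤ D / 2 := by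
    intro s hs
    by_contra hlt
    push Not at hlt
    obtain ⟨s', hs', hsd'⟩ := intermediate_value_Icc hs.1
      (hc.mono ((Set.Icc_subset_Icc_right hs.2).trans hsub))
      (show D / 2 ∈ Set.Icc _ _ from ⟨by rw [h0, dist_self]; positivity, hlt.le⟩)
    have h2 := hmin ⟨hsub ⟨hs'.1, hs'.2.trans hs.2⟩, hsd'⟩
    have h3 : s = τ := le_antisymm hs.2 (h2.trans hs'.2)
    rw [h3, hτd] at hlt
    exact lt_irrefl _ hlt
  have hlow : ∀ s ∈ Set.Icc (0 : ℝ) τ, ε / 2 * dist (γ s) x ≤ distBd Ω (γ s) := by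
    intro s hs
    refine le_trans ?_ (hdist s (hsub hs))
    have h2 := dist_triangle_left x y (γ s)
    have h3 := hle s hs
    have h4 : D / 2 ≤ dist (γ s) y := by linarith
    rw [le_div_iff₀ hD0]
    have : 0 ≤ ε * dist (γ s) x := by positivity
    nlinarith
  have hnear : ∀ s ∈ Set.Icc (0 : ℝ) τ, ε * d / 4 ≤ distBd Ω (γ s) := by
    intro s hs
    by_cases hq : dist (γ s) x ≤ d / 2
    · have := abs_le.1 (abs_distBd_sub_le Ω (γ s) x)
      nlinarith [this.1]
    · push Not at hq
      have := hlow s hs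
      nlinarith
  have hstep : ∀ s ∈ Set.Icc (0 : ℝ) τ, ∀ t ∈ Set.Icc (0 : ℝ) τ,
      dist (γ s) (γ t) ≤ ε * d / 16 →
      |centerMean Ω f (γ s) - centerMean Ω f (γ t)| ≤ 2 * 3 ^ n * η := by
    intro s hs t ht hst
    have hs1 := hnear s hs
    have hs0 : 0 < distBd Ω (γ s) := lt_of_lt_of_le (by positivity) hs1
    have hsΩ := hγΩ s (hsub hs)
    refine abs_centerMean_sub_le hf hsΩ hs0 (by linarith) (hη _ ?_ ?_)
    · exact closedBall_subset_of_lt_distBd hsΩ (by positivity) (by linarith)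
    · intro z hz
      have hz' : dist z (γ s) ≤ 7 / 8 * distBd Ω (γ s) := hz
      have h2 := abs_le.1 (abs_distBd_sub_le Ω (γ s) x)
      have h3 := abs_le.1 (abs_distBd_sub_le Ω z (γ s))
      have h4 := hle s hs
      have h5 : D = 8 * (d / ε) := by rw [hxy]; ring
      have h6 : 10 * d / ε = 10 * (d / ε) := by ring
      rw [h6]
      linarith [h2.2, h3.2]
  have hlen' : eVariationOn γ (Set.Icc 0 τ)
      ≤ ENNReal.ofReal ((⌈128 / ε ^ 3⌉₊ : ℕ) * (ε * d / 16)) := by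
    refine (eVariationOn.mono γ hsub).trans (hlen.trans (ENNReal.ofReal_le_ofReal ?_))
    have h2 : 128 / ε ^ 3 * (ε * d / 16) ≤ (⌈128 / ε ^ 3⌉₊ : ℕ) * (ε * d / 16) :=
      mul_le_mul_of_nonneg_right (Nat.le_ceil _) (by positivity)
    refine le_trans (le_of_eq ?_) h2
    rw [hxy]; field_simp; ring
  have hmain := abs_sub_le_of_eVariationOn_le (v := fun t => centerMean Ω f (γ t))
    (by positivity : 0 < ε * d / 16) _ 0 τ hτ.1 (hγ.mono hsub) hstep hlen'
  refine ⟨γ τ, hγΩ τ hτ, ?_, ?_⟩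
  · have := hlow τ ⟨hτ.1, le_rfl⟩
    rw [hτd] at this
    nlinarith
  · rw [h0] at hmain
    refine hmain.trans (le_of_eq ?_)
    unfold stepConst; ring

end Doubling

section Growth

variable {Ω : Set (Fin n → ℝ)} {f : (Fin n → ℝ) → ℝ} {ε δ : ℝ}

lemma abs_le_add_mul_of_double {u : (Fin n → ℝ) → ℝ} {s B K : ℝ} (hK : 0 ≤ K)
    (hbase : ∀ x ∈ Ω, s ≤ distBd Ω x → |u x| ≤ B)
    (hstep : ∀ x ∈ Ω, distBd Ω x < s → ∃ z ∈ Ω, 2 * distBd Ω x ≤ distBd Ω z ∧ |u x - u z| ≤ K)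
    (k : ℕ) : ∀ x ∈ Ω, s / 2 ^ k ≤ distBd Ω x → |u x| ≤ B + k * K := by
  induction k with
  | zero => intro x hx h; simpa using hbase x hx (by simpa using h)
  | succ k ih =>
    intro x hx h
    push_cast
    rcases lt_or_ge (distBd Ω x) s with hlt | hge
    · obtain ⟨z, hz, h2, h3⟩ := hstep x hx hlt
      have h4 : s / 2 ^ k = 2 * (s / 2 ^ (k + 1)) := by rw [pow_succ]; field_simp
      have h5 := ih z hz (by linarith)
      have := abs_add_le (u x - u z) (u z)
      rw [sub_add_cancel] at this
      linarith
    · have := hbase x hx hge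
      have : 0 ≤ (k + 1) * K := by positivity
      linarith

lemma lamED_le (hn : 0 < n) (hε : 0 < ε) (hε1 : ε ≤ 1) (hδ : 0 < δ) :
    lamED n ε δ ≤ ε * δ / 16 := by
  have hn' : (1 : ℝ) ≤ n := by exact_mod_cast hn
  have h1 : 0 ≤ Real.sqrt n * ε := by positivity
  have h2 : (320 : ℝ) ≤ 320 * n * (1 + Real.sqrt n * ε) := by nlinarith
  have h3 : 0 < ε * δ := by positivity
  unfold lamED
  rw [div_le_iff₀ (by linarith)]
  nlinarith

lemma lamED_pos (hn : 0 < n) (hε : 0 < ε) (hδ : 0 < δ) : 0 < lamED n ε δ := by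
  have hn' : (0 : ℝ) < n := by exact_mod_cast hn
  unfold lamED
  positivity

lemma exists_dist_eq_of_isConnected (hc : IsConnected Ω) {x y : Fin n → ℝ} (hx : x ∈ Ω)
    (hy : y ∈ Ω) {D : ℝ} (hD0 : 0 ≤ D) (hD : D ≤ dist x y) : ∃ z ∈ Ω, dist x z = D := by
  have := hc.isPreconnected.intermediate_value hx hy
    (f := fun z => dist x z) (by fun_prop) (show D ∈ Set.Icc _ _ by simpa using ⟨hD0, hD⟩)
  simpa using this

/-- Points at a definite distance from the boundary have bounded means, and from all other points
there are points of the domain at the distance needed for the doubling step. -/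
lemma exists_base (hn : 0 < n) (hε : 0 < ε) (hε1 : ε ≤ 1) (hδ : 0 < δ) (hΩ : IsRealDomain Ω)
    (hf : MemBmo Ω (lamED n ε δ) f) :
    ∃ s > 0, ∃ B ≥ 0, (∀ x ∈ Ω, s ≤ distBd Ω x → |centerMean Ω f x| ≤ B) ∧
      ∀ x ∈ Ω, distBd Ω x < s → ∃ y ∈ Ω, dist x y = 8 * distBd Ω x / ε ∧ dist x y < δ := by
  have hbound : ∀ {s x}, s ≤ ε * δ / 16 → distBd Ω x < s → 8 * distBd Ω x / ε < δ := by
    intro s x h1 h2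
    rw [div_lt_iff₀ hε]
    have : 0 < δ * ε := by positivity
    linarith
  have hpos : ∀ x, 0 ≤ 8 * distBd Ω x / ε := fun x =>
    div_nonneg (mul_nonneg (by norm_num) infDist_nonneg) hε.le
  by_cases hb : Bornology.IsBounded Ω
  · have : Nonempty (Fin n) := ⟨⟨0, hn⟩⟩
    obtain ⟨a, ha, b, hbΩ, hab⟩ : Ω.Nontrivial := by
      have hinf : Ω.Infinite := infinite_of_mem_nhds hΩ.2.nonempty.some
        (hΩ.1.mem_nhds hΩ.2.nonempty.some_mem)
      exact hinf.nontrivial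
    have hab0 : 0 < dist a b := dist_pos.2 hab
    set s := min (ε * δ / 16) (ε * dist a b / 16) with hs
    have hs0 : 0 < s := lt_min (by positivity) (by positivity)
    obtain ⟨A, hA0, hA⟩ := hf.exists_osc_le
    have hcompact : IsCompact {x | x ∈ Ω ∧ s ≤ distBd Ω x} := by
      refine Metric.isCompact_of_isClosed_isBounded ?_ (hb.subset fun x hx => hx.1)
      have : {x | x ∈ Ω ∧ s ≤ distBd Ω x} = closure Ω ∩ {x | s ≤ distBd Ω x} := by
        ext x
        refine ⟨fun h => ⟨subset_closure h.1, h.2⟩, fun h => ⟨?_, h.2⟩⟩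
        by_contra hx
        have hxf : x ∈ frontier Ω := by rw [hΩ.1.frontier_eq]; exact ⟨h.1, hx⟩
        have h0 : distBd Ω x = 0 := infDist_zero_of_mem hxf
        have : s ≤ distBd Ω x := h.2
        linarith
      rw [this]
      exact isClosed_closure.inter (isClosed_le continuous_const (continuous_distBd Ω))
    have hex : ∃ B, ∀ x ∈ {x | x ∈ Ω ∧ s ≤ distBd Ω x}, |centerMean Ω f x| ≤ B := by
      refine hcompact.induction_on (p := fun S => ∃ B, ∀ x ∈ S, |centerMean Ω f x| ≤ B)
        ⟨0, by simp⟩ (fun S T hST ⟨B, hB⟩ => ⟨B, fun x hx => hB x (hST hx)⟩)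
        (fun S T ⟨B, hB⟩ ⟨C, hC⟩ => ⟨max B C, fun x hx => hx.elim
          (fun h => (hB x h).trans (le_max_left _ _)) fun h => (hC x h).trans (le_max_right _ _)⟩)
        fun x hx => ?_
      have hd : 0 < distBd Ω x := hs0.trans_le hx.2
      refine ⟨closedBall x (distBd Ω x / 4),
        mem_nhdsWithin_of_mem_nhds (closedBall_mem_nhds x (by positivity)),
        |centerMean Ω f x| + 2 * 3 ^ n * A, fun y hy => ?_⟩
      have h1 := abs_centerMean_sub_le hf.1 hx.1 hd (by rwa [dist_comm])
        (hA _ (closedBall_subset_of_lt_distBd (r := 7 / 8 * distBd Ω x) hx.1 (by positivity)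
          (by linarith)))
      have := abs_sub_abs_le_abs_sub (centerMean Ω f y) (centerMean Ω f x)
      rw [abs_sub_comm] at this
      linarith
    obtain ⟨B, hB⟩ := hex
    refine ⟨s, hs0, max B 0, le_max_right _ _,
      fun x hx h => (hB x ⟨hx, h⟩).trans (le_max_left _ _), fun x hx h => ?_⟩
    have hD : 8 * distBd Ω x / ε ≤ dist a b / 2 := by
      rw [div_le_iff₀ hε]
      have := h.trans_le (min_le_right _ _)
      linarith
    obtain ⟨p, hp, hxp⟩ : ∃ p ∈ Ω, dist a b / 2 ≤ dist x p := by
      by_contra! hcon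
      have h1 := hcon a ha
      have h2 := hcon b hbΩ
      have := dist_triangle_left a b x
      linarith
    obtain ⟨z, hz, hxz⟩ := exists_dist_eq_of_isConnected hΩ.2 hx hp (hpos x) (hD.trans hxp)
    exact ⟨z, hz, hxz, hxz ▸ hbound (min_le_left _ _) h⟩
  · refine ⟨ε * δ / 16, by positivity, bigAvgSup Ω (lamED n ε δ) f, bigAvgSup_nonneg _ _ _,
      fun x hx h => ?_, fun x hx h => ?_⟩
    · have hd : 0 < distBd Ω x := lt_of_lt_of_le (by positivity) h
      rw [centerMean_eq_avg (half_pos hd)]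
      refine (Cube.abs_avg_le _ _).trans (hf.avgAbs_le_bigAvgSup ?_ ?_)
      · exact closedBall_subset_of_lt_distBd (r := distBd Ω x / 2) hx (by positivity) (by linarith)
      · have := lamED_le hn hε hε1 hδ
        simp only [Cube.side]
        linarith
    · obtain ⟨p, hp, hxp⟩ : ∃ p ∈ Ω, 8 * distBd Ω x / ε ≤ dist x p := by
        by_contra! hcon
        refine hb ((Metric.isBounded_closedBall (x := x) (r := 8 * distBd Ω x / ε)).subset ?_)
        intro p hp
        rw [mem_closedBall, dist_comm]
        exact (hcon p hp).le
      obtain ⟨z, hz, hxz⟩ := exists_dist_eq_of_isConnected hΩ.2 hx hp (hpos x) hxp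
      exact ⟨z, hz, hxz, hxz ▸ hbound le_rfl h⟩

/-- If the oscillation of `f` near the boundary is at most `η`, the means of `f` grow at most
like `η` times the logarithm of the distance to the boundary. -/
lemma IsEpsDeltaDomain.exists_abs_centerMean_le (hn : 0 < n) (hε : 0 < ε) (hε1 : ε ≤ 1)
    (hδ : 0 < δ) (hΩ : IsRealDomain Ω) (hed : IsEpsDeltaDomain Ω ε δ)
    (hfr : (frontier Ω).Nonempty) (hf : MemBmo Ω (lamED n ε δ) f) {t η : ℝ} (ht : 0 < t)
    (hη0 : 0 ≤ η)
    (hη : ∀ Q : Cube n, Q.toSet ⊆ Ω → (∀ z ∈ Q.toSet, distBd Ω z < t) → Q.osc f ≤ η) :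
    ∃ B ≥ 0, ∀ k : ℕ, ∀ x ∈ Ω, (1 / 2 : ℝ) ^ k / 2 ≤ distBd Ω x →
      |centerMean Ω f x| ≤ B + k * (stepConst n ε * η) := by
  obtain ⟨s, hs, B, hB, hbase, hreach⟩ := exists_base hn hε hε1 hδ hΩ hf
  obtain ⟨A, hA0, hA⟩ := hf.exists_osc_le
  have hκ := stepConst_pos n ε
  set s' := min s (min (ε * t / 10) (1 / 2)) with hs'
  have hs'0 : 0 < s' := lt_min hs (lt_min (by positivity) (by norm_num))
  obtain ⟨j, hj⟩ := exists_pow_lt_of_lt_one (div_pos hs'0 hs) (by norm_num : (1 / 2 : ℝ) < 1)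
  have hj' : s / 2 ^ j ≤ s' := by
    rw [lt_div_iff₀ hs, one_div, inv_pow, inv_mul_eq_div] at hj
    exact hj.le
  have h1 := abs_le_add_mul_of_double (mul_nonneg hκ.le hA0) hbase (fun x hx hxs => by
    obtain ⟨y, hy, hxy, hyδ⟩ := hreach x hx hxs
    exact hed.exists_double hε hε1 hf.1 hx (distBd_pos hΩ.1 hfr hx) hy hxy hyδ
      (fun Q hQ _ => hA Q hQ)) j
  refine ⟨B + j * (stepConst n ε * A), by positivity, fun k x hx hk => ?_⟩
  refine abs_le_add_mul_of_double (s := s') (mul_nonneg hκ.le hη0)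
    (fun x hx hxs => h1 x hx (hj'.trans hxs)) (fun x hx hxs => ?_) k x hx ?_
  · obtain ⟨y, hy, hxy, hyδ⟩ := hreach x hx (hxs.trans_le (min_le_left _ _))
    refine hed.exists_double hε hε1 hf.1 hx (distBd_pos hΩ.1 hfr hx) hy hxy hyδ
      fun Q hQ hz => hη Q hQ fun z hzQ => (hz z hzQ).trans ?_
    have := hxs.trans_le ((min_le_right _ _).trans (min_le_left _ _))
    rw [div_lt_iff₀ hε]
    linarith
  · refine le_trans ?_ hk
    have : s' ≤ 1 / 2 := (min_le_right _ _).trans (min_le_right _ _)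
    rw [one_div, inv_pow, div_eq_mul_inv s', mul_comm s', div_eq_mul_inv _ (2 : ℝ), ← one_div 2]
    exact mul_le_mul_of_nonneg_left this (by positivity)

end Growth

section Cutoff

variable {Ω : Set (Fin n → ℝ)} {m : ℕ} {x y : Fin n → ℝ}

/-- A logarithmic cutoff, equal to `1` where `dist(x, ∂Ω) ≤ 2 ^ (-2m)` and to `0` where
`dist(x, ∂Ω) ≥ 2 ^ (-m)`. -/
def cutoff (Ω : Set (Fin n → ℝ)) (m : ℕ) (x : Fin n → ℝ) : ℝ :=
  max 0 (min 1 ((Real.log ((1 / 2) ^ m) - Real.log (distBd Ω x)) / (m * Real.log 2)))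

lemma cutoff_nonneg : 0 ≤ cutoff Ω m x := le_max_left _ _

lemma cutoff_le_one : cutoff Ω m x ≤ 1 := max_le zero_le_one (min_le_left _ _)

lemma abs_cutoff_le_one : |cutoff Ω m x| ≤ 1 := by
  rw [abs_of_nonneg cutoff_nonneg]; exact cutoff_le_one

lemma measurable_cutoff (Ω : Set (Fin n → ℝ)) (m : ℕ) : Measurable (cutoff Ω m) := by
  have := (continuous_distBd Ω).measurable
  unfold cutoff
  fun_prop

lemma cutoff_eq_zero (h : (1 / 2 : ℝ) ^ m ≤ distBd Ω x) : cutoff Ω m x = 0 := by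
  refine max_eq_left ((min_le_right _ _).trans (div_nonpos_of_nonpos_of_nonneg ?_ ?_))
  · exact sub_nonpos.2 (Real.log_le_log (by positivity) h)
  · exact mul_nonneg m.cast_nonneg (Real.log_nonneg one_le_two)

lemma cutoff_eq_one (hm : 0 < m) (h0 : 0 < distBd Ω x) (h : distBd Ω x ≤ (1 / 2) ^ (2 * m)) :
    cutoff Ω m x = 1 := by
  have hL : 0 < m * Real.log 2 := mul_pos (by exact_mod_cast hm) (Real.log_pos one_lt_two)
  have h1 := Real.log_le_log h0 h
  have h2 : 1 ≤ (Real.log ((1 / 2) ^ m) - Real.log (distBd Ω x)) / (m * Real.log 2) := by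
    rw [le_div_iff₀ hL]
    rw [one_div, Real.log_pow, Real.log_inv] at h1 ⊢
    push_cast at h1
    linarith
  rw [cutoff, min_eq_left h2, max_eq_right zero_le_one]

lemma abs_cutoff_sub_le (hm : 0 < m) :
    |cutoff Ω m x - cutoff Ω m y| ≤
      2 / m * |Real.log (distBd Ω x) - Real.log (distBd Ω y)| := by
  have hm' : (0 : ℝ) < m := by exact_mod_cast hm
  have hlog : (1 / 2 : ℝ) ≤ Real.log 2 := by linarith [Real.log_two_gt_d9]
  have hL : 0 < m * Real.log 2 := by positivity
  have hclamp : ∀ a b : ℝ, |max 0 (min 1 a) - max 0 (min 1 b)| ≤ |a - b| := fun a b => by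
    refine (abs_max_sub_max_le_max _ _ _ _).trans ?_
    rw [sub_self, abs_zero, max_eq_right (abs_nonneg _)]
    refine (abs_min_sub_min_le_max _ _ _ _).trans ?_
    rw [sub_self, abs_zero, max_eq_right (abs_nonneg _)]
  refine (hclamp _ _).trans ?_
  rw [← sub_div, sub_sub_sub_cancel_left, abs_div, abs_of_pos hL, abs_sub_comm,
    div_eq_inv_mul]
  refine mul_le_mul_of_nonneg_right ?_ (abs_nonneg _)
  rw [inv_le_comm₀ hL (by positivity), inv_div]
  nlinarith

lemma integrableOn_cutoff_mul (Ω : Set (Fin n → ℝ)) (m : ℕ) {f : (Fin n → ℝ) → ℝ} {Q : Cube n}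
    (hf : IntegrableOn f Q.toSet) : IntegrableOn (fun x => cutoff Ω m x * f x) Q.toSet :=
  hf.bdd_mul (c := 1) (measurable_cutoff Ω m).aestronglyMeasurable
    (.of_forall fun _ => abs_cutoff_le_one)

lemma integrableOn_cutoff (Ω : Set (Fin n → ℝ)) (m : ℕ) (Q : Cube n) :
    IntegrableOn (cutoff Ω m) Q.toSet := by
  simpa using integrableOn_cutoff_mul Ω m (Q.integrableOn_const' 1)

lemma avg_abs_cutoff_sub_le (hn : 0 < n) (hm : 0 < m) {Q : Cube n}
    (hQ : Q.half < distBd Ω Q.center) :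
    Q.avg (fun x => |cutoff Ω m x - cutoff Ω m Q.center|) ≤
      (8 * n + 4) / m * (Q.half / distBd Ω Q.center) := by
  have hm' : (0 : ℝ) < m := by exact_mod_cast hm
  obtain ⟨h1, h2⟩ := Q.avg_abs_log_sub_log_le hn (abs_distBd_sub_le Ω) hQ
  calc Q.avg (fun x => |cutoff Ω m x - cutoff Ω m Q.center|)
      ≤ Q.avg (fun x => 2 / m * |Real.log (distBd Ω x) - Real.log (distBd Ω Q.center)|) :=
        Cube.avg_mono (Cube.integrableOn_abs_sub (integrableOn_cutoff Ω m Q) _)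
          (h1.const_mul _) fun x _ => abs_cutoff_sub_le hm
    _ ≤ 2 / m * ((4 * n + 2) * (Q.half / distBd Ω Q.center)) := by
        rw [Cube.avg_const_mul]
        exact mul_le_mul_of_nonneg_left h2 (by positivity)
    _ = _ := by ring

end Cutoff

section Truncation

variable {Ω : Set (Fin n → ℝ)} {f : (Fin n → ℝ) → ℝ}

/-- The mean over a cube is controlled by the mean over the concentric cube of size comparable to
the distance to the boundary, up to the ratio of the two sizes. -/
lemma ratio_mul_abs_avg_le {c : Fin n → ℝ} {h η : ℝ} (h0 : 0 < h) (hc : h < distBd Ω c)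
    (hf : ∀ s (hs : 0 < s), s < distBd Ω c → IntegrableOn f (⟨c, s, hs⟩ : Cube n).toSet)
    (hη : ∀ s (hs : 0 < s), s < distBd Ω c → (⟨c, s, hs⟩ : Cube n).osc f ≤ η) :
    h / distBd Ω c * |(⟨c, h, h0⟩ : Cube n).avg f| ≤ |centerMean Ω f c| + 2 ^ n * η := by
  set d := distBd Ω c with hd
  have hd0 : 0 < d := h0.trans hc
  have hη0 : 0 ≤ η := (Cube.osc_nonneg _ f).trans (hη h h0 hc)
  have hd2 : 0 < d / 2 := by positivity
  have hratio : h / d ≤ 1 := (div_le_one hd0).2 hc.le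
  have hratio0 : 0 ≤ h / d := by positivity
  rw [centerMean_eq_avg (show 0 < distBd Ω c / 2 from hd2)]
  set u := (⟨c, distBd Ω c / 2, hd2⟩ : Cube n).avg f with hu
  set v := (⟨c, h, h0⟩ : Cube n).avg f with hv
  have huv : |v| ≤ |u| + |v - u| := by
    have := abs_add_le u (v - u); rwa [add_sub_cancel] at this
  have key : h / d * |v - u| ≤ 2 ^ n * η := by
    rcases lt_or_ge (d / 2) h with hlt | hge
    · have h1 := Cube.abs_avg_sub_avg_le (P := ⟨c, d / 2, hd2⟩) (Q := ⟨c, h, h0⟩) (f := f)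
        (closedBall_subset_closedBall hlt.le) (hf h h0 hc)
      have h2 : (h / (d / 2)) ^ n ≤ 2 ^ n := by
        refine pow_le_pow_left₀ (by positivity) ?_ n
        rw [div_le_iff₀ hd2]; linarith
      have h3 := h1.trans (mul_le_mul h2 (hη h h0 hc) (Cube.osc_nonneg _ f) (by positivity))
      rw [abs_sub_comm] at h3
      exact (mul_le_of_le_one_left (abs_nonneg _) hratio).trans h3
    · obtain ⟨j, hj1, hj2⟩ := exists_nat_pow_near (x := d / (2 * h)) (y := 2)
        ((one_le_div (by positivity)).2 (by linarith)) one_lt_two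
      have h1 := Cube.abs_avg_sub_avg_concentric_le hd2 (hf _ hd2 (by linarith))
        (fun s hs hsd => hη s hs (by linarith)) (j + 1) h h0 hge (by
          rw [div_lt_iff₀ (by positivity)] at hj2; linarith)
      have h2 : ((j + 1 : ℕ) : ℝ) ≤ 2 ^ j := by exact_mod_cast Nat.succ_le_of_lt Nat.lt_two_pow_self
      have h3 : h / d * ((j + 1 : ℕ) : ℝ) ≤ 1 := by
        have h4 := h2.trans hj1
        rw [le_div_iff₀ (by positivity)] at h4
        rw [div_mul_eq_mul_div, div_le_one hd0]
        have : (0 : ℝ) ≤ ((j + 1 : ℕ) : ℝ) * h := by positivity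
        linarith
      calc h / d * |v - u| ≤ h / d * (((j + 1 : ℕ) : ℝ) * (2 ^ n * η)) :=
            mul_le_mul_of_nonneg_left h1 hratio0
        _ = h / d * ((j + 1 : ℕ) : ℝ) * (2 ^ n * η) := by ring
        _ ≤ 1 * (2 ^ n * η) := mul_le_mul_of_nonneg_right h3 (by positivity)
        _ = 2 ^ n * η := one_mul _
  calc h / d * |v| ≤ h / d * (|u| + |v - u|) := mul_le_mul_of_nonneg_left huv hratio0
    _ = h / d * |u| + h / d * |v - u| := mul_add _ _ _
    _ ≤ |u| + 2 ^ n * η := add_le_add (mul_le_of_le_one_left (abs_nonneg _) hratio) key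

/-- The oscillation of a truncation of `f` on a small cube near the boundary. -/
lemma avg_abs_cutoff_mul_sub_le (hn : 0 < n) (hΩ : IsOpen Ω) (hfr : (frontier Ω).Nonempty)
    (hf : ∀ Q : Cube n, Q.toSet ⊆ Ω → IntegrableOn f Q.toSet) {t η W : ℝ} {m : ℕ} (hm : 0 < m)
    (hη : ∀ Q : Cube n, Q.toSet ⊆ Ω → (∀ z ∈ Q.toSet, distBd Ω z < t) → Q.osc f ≤ η)
    (hW : ∀ x ∈ Ω, (1 / 2 : ℝ) ^ (2 * m) / 2 ≤ distBd Ω x → |centerMean Ω f x| ≤ W)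
    (hW0 : 0 ≤ W) (hmt : (1 / 2 : ℝ) ^ m ≤ t / 16) {Q : Cube n} (hQ : Q.toSet ⊆ Ω)
    (hh : Q.half < t / 8) {y : Fin n → ℝ} (hy : y ∈ Q.toSet) (hyd : distBd Ω y < (1 / 2) ^ m) :
    Q.avg (fun x => |cutoff Ω m x * f x - cutoff Ω m Q.center * Q.avg f|) ≤
      η + (8 * n + 4) / m * (W + 2 ^ n * η) := by
  have hm' : (0 : ℝ) < m := by exact_mod_cast hm
  have hQc : Q.half < distBd Ω Q.center := Q.half_lt_distBd hΩ hfr hQ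
  have hcΩ : Q.center ∈ Ω := hQ Q.center_mem
  have hd0 := Q.half_pos.trans hQc
  have hnear : ∀ z ∈ Q.toSet, |distBd Ω z - distBd Ω Q.center| ≤ Q.half := fun z hz =>
    (abs_distBd_sub_le Ω z Q.center).trans hz
  have hdc : distBd Ω Q.center < 3 * t / 16 := by linarith [(abs_le.1 (hnear y hy)).1]
  have hosc : ∀ s (hs : 0 < s), s < distBd Ω Q.center →
      (⟨Q.center, s, hs⟩ : Cube n).osc f ≤ η := fun s hs hsd =>
    hη _ (closedBall_subset_of_lt_distBd hcΩ hs.le hsd) fun z hz => by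
      have h1 : dist z Q.center ≤ s := hz
      linarith [(abs_le.1 ((abs_distBd_sub_le Ω z Q.center).trans h1)).2]
  have hoscQ : Q.osc f ≤ η := hosc Q.half Q.half_pos hQc
  have hη0 := (Q.osc_nonneg f).trans hoscQ
  have hint := hf Q hQ
  have hi1 := Cube.integrableOn_abs_sub hint (Q.avg f)
  have hi2 := Cube.integrableOn_abs_sub (integrableOn_cutoff Ω m Q) (cutoff Ω m Q.center)
  have hsplit : Q.avg (fun x => |cutoff Ω m x * f x - cutoff Ω m Q.center * Q.avg f|) ≤
      Q.osc f + |Q.avg f| * Q.avg (fun x => |cutoff Ω m x - cutoff Ω m Q.center|) := by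
    rw [Cube.osc_eq, ← Q.avg_const_mul |Q.avg f|, ← Cube.avg_add hi1 (hi2.const_mul _)]
    refine Cube.avg_mono (Cube.integrableOn_abs_sub (integrableOn_cutoff_mul Ω m hint) _)
      (hi1.add (hi2.const_mul _)) fun x _ => ?_
    calc |cutoff Ω m x * f x - cutoff Ω m Q.center * Q.avg f|
        = |cutoff Ω m x * (f x - Q.avg f) + Q.avg f * (cutoff Ω m x - cutoff Ω m Q.center)| := by
          congr 1; ring
      _ ≤ |cutoff Ω m x * (f x - Q.avg f)| + |Q.avg f * (cutoff Ω m x - cutoff Ω m Q.center)| :=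
          abs_add_le _ _
      _ ≤ |f x - Q.avg f| + |Q.avg f| * |cutoff Ω m x - cutoff Ω m Q.center| := by
          rw [abs_mul, abs_mul]
          exact add_le_add_left (mul_le_of_le_one_left (abs_nonneg _) abs_cutoff_le_one) _
  refine hsplit.trans (add_le_add hoscQ ?_)
  rcases lt_or_ge (distBd Ω Q.center) ((1 / 2) ^ (2 * m) / 2) with hlt | hge
  · have hone : ∀ z ∈ Q.toSet, cutoff Ω m z = 1 := fun z hz =>
      cutoff_eq_one hm (distBd_pos hΩ hfr (hQ hz)) (by linarith [(abs_le.1 (hnear z hz)).2])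
    have : Q.avg (fun x => |cutoff Ω m x - cutoff Ω m Q.center|) = 0 := by
      rw [Cube.avg_congr (g := fun _ => 0) fun x hx => by
        rw [hone x hx, hone _ Q.center_mem, sub_self, abs_zero], Cube.avg_const]
    rw [this, mul_zero]
    positivity
  · have h1 := avg_abs_cutoff_sub_le hn hm hQc
    have h2 := ratio_mul_abs_avg_le (f := f) Q.half_pos hQc
      (fun s hs hsd => hf _ (closedBall_subset_of_lt_distBd hcΩ hs.le hsd)) hosc
    calc |Q.avg f| * Q.avg (fun x => |cutoff Ω m x - cutoff Ω m Q.center|)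
        ≤ |Q.avg f| * ((8 * n + 4) / m * (Q.half / distBd Ω Q.center)) :=
          mul_le_mul_of_nonneg_left h1 (abs_nonneg _)
      _ = (8 * n + 4) / m * (Q.half / distBd Ω Q.center * |Q.avg f|) := by ring
      _ ≤ (8 * n + 4) / m * (W + 2 ^ n * η) := by
          refine mul_le_mul_of_nonneg_left (h2.trans ?_) (by positivity)
          linarith [hW _ hcΩ hge]

end Truncation

section Approximation

variable {Ω : Set (Fin n → ℝ)} {f : (Fin n → ℝ) → ℝ}

/-- If the truncation of `f` has small oscillation on the small cubes near the boundary, then it is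
small on all cubes. -/
lemma osc_le_and_avgAbs_le_of_cutoff (hΩ : IsOpen Ω) (hfr : (frontier Ω).Nonempty)
    (hf : ∀ Q : Cube n, Q.toSet ⊆ Ω → IntegrableOn f Q.toSet) {t K : ℝ} (ht : 0 < t) (hK : 0 ≤ K)
    {m : ℕ} (hmt : (1 / 2 : ℝ) ^ m ≤ t / 16)
    (hkey : ∀ Q : Cube n, Q.toSet ⊆ Ω → Q.half < t / 8 →
      (∃ y ∈ Q.toSet, distBd Ω y < (1 / 2) ^ m) →
      Q.avg (fun x => |cutoff Ω m x * f x - cutoff Ω m Q.center * Q.avg f|) ≤ K)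
    {Q : Cube n} (hQ : Q.toSet ⊆ Ω) :
    Q.osc (fun x => cutoff Ω m x * f x) ≤ 2 * K ∧
      (t / 8 ≤ Q.half → Q.avgAbs (fun x => cutoff Ω m x * f x) ≤ K) := by
  have hzero : ∀ P : Cube n, (¬ ∃ y ∈ P.toSet, distBd Ω y < (1 / 2) ^ m) →
      P.avgAbs (fun x => cutoff Ω m x * f x) ≤ K := by
    intro P hP
    push Not at hP
    rw [Cube.avgAbs_congr (g := fun _ => 0) fun x hx => by
      rw [cutoff_eq_zero (hP x hx), zero_mul], Cube.avgAbs_eq]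
    simpa [Cube.avg_const] using hK
  have hbig : t / 8 ≤ Q.half → Q.avgAbs (fun x => cutoff Ω m x * f x) ≤ K := by
    intro hle
    have hQ0 := Q.half_pos
    set k := ⌊8 * Q.half / t⌋₊ + 1 with hk
    have hk0 : 0 < k := Nat.succ_pos _
    have hk0' : (0 : ℝ) < k := by exact_mod_cast hk0
    have hk1 : 8 * Q.half / t < k := by rw [hk]; push_cast; exact Nat.lt_floor_add_one _
    have hk2 : (k : ℝ) ≤ 16 * Q.half / t := by
      have h1 := Nat.floor_le (a := 8 * Q.half / t) (by positivity)
      have h2 : 1 ≤ 8 * Q.half / t := by rw [le_div_iff₀ ht]; linarith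
      rw [hk]; push_cast
      have h3 : 16 * Q.half / t = 8 * Q.half / t + 8 * Q.half / t := by ring
      linarith
    rw [div_lt_iff₀ ht] at hk1
    rw [le_div_iff₀ ht] at hk2
    refine Cube.avg_le_of_subcube hk0 (integrableOn_cutoff_mul Ω m (hf Q hQ)).abs
      (fun _ _ => abs_nonneg _) fun i => ?_
    have hP := (Q.subcube_subset k hk0 i).trans hQ
    set P := Q.subcube k hk0 i
    have hPh : P.half = Q.half / k := rfl
    have hP1 : P.half < t / 8 := by rw [hPh, div_lt_iff₀ hk0']; linarith
    have hP2 : t / 16 ≤ P.half := by rw [hPh, le_div_iff₀ hk0']; linarith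
    by_cases hex : ∃ y ∈ P.toSet, distBd Ω y < (1 / 2) ^ m
    · have h1 := hkey P hP hP1 hex
      have h2 := P.half_lt_distBd hΩ hfr hP
      rw [cutoff_eq_zero (x := P.center) (by linarith)] at h1
      simpa using h1
    · exact hzero P hex
  refine ⟨?_, hbig⟩
  have hint := integrableOn_cutoff_mul Ω m (hf Q hQ)
  by_cases hex : ∃ y ∈ Q.toSet, distBd Ω y < (1 / 2) ^ m
  · rcases lt_or_ge Q.half (t / 8) with hlt | hge
    · linarith [hkey Q hQ hlt hex, Cube.osc_le_two_mul hint (cutoff Ω m Q.center * Q.avg f)]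
    · linarith [hbig hge, Cube.osc_le_two_mul_avgAbs hint]
  · linarith [hzero Q hex, Cube.osc_le_two_mul_avgAbs hint]

lemma VanishAtBoundary.exists_osc_le {lam : ℝ} (hlam : 0 < lam) (hΩ : IsOpen Ω)
    (hfr : (frontier Ω).Nonempty) (hf : MemBmo Ω lam f) (hv : VanishAtBoundary Ω lam f) {η : ℝ}
    (hη : 0 < η) : ∃ t > 0, t ≤ lam / 2 ∧
      ∀ Q : Cube n, Q.toSet ⊆ Ω → (∀ z ∈ Q.toSet, distBd Ω z < t) → Q.osc f ≤ η := by
  have h1 : ∀ᶠ t in nhdsWithin (0 : ℝ) (Set.Ioi 0), bmoNorm (Ω \ innerPart Ω t) lam f < η :=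
    hv.eventually (gt_mem_nhds hη)
  have h2 : ∀ᶠ t in nhdsWithin (0 : ℝ) (Set.Ioi 0), t ∈ Set.Ioc 0 (lam / 2) :=
    Ioc_mem_nhdsGT (by positivity)
  obtain ⟨t, ht, ht0, htl⟩ := (h1.and h2).exists
  refine ⟨t, ht0, htl, fun Q hQ hz => ?_⟩
  have hsub : Q.toSet ⊆ Ω \ innerPart Ω t := fun z hzQ =>
    ⟨hQ hzQ, fun hin => (hz z hzQ).not_ge hin.2⟩
  have hside : Q.side < lam := by
    have := Q.half_lt_distBd hΩ hfr hQ
    have := hz _ Q.center_mem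
    rw [Cube.side]; linarith
  have h3 := (hf.mono Set.sdiff_subset).osc_le_omegaOn hsub hside
  have h4 := bigAvgSup_nonneg (Ω \ innerPart Ω t) lam f
  rw [bmoNorm] at ht
  linarith

/-- The part of `f` left after truncation is supported away from the boundary. -/
lemma suppAway_indicator_sub_cutoff (hΩ : IsOpen Ω) (hfr : (frontier Ω).Nonempty) {m : ℕ}
    (hm : 0 < m) :
    SuppAway Ω (Ω.indicator (f - fun x => cutoff Ω m x * f x)) := by
  refine ⟨(1 / 2) ^ (2 * m), by positivity, fun x hx y hy => ?_⟩
  refine le_trans ?_ (infDist_le_dist_of_mem hy)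
  rw [Function.mem_support] at hx
  by_contra hlt
  have hxΩ : x ∈ Ω := by
    by_contra h; exact hx (Set.indicator_of_notMem h _)
  refine hx ?_
  rw [Set.indicator_of_mem hxΩ, Pi.sub_apply,
    cutoff_eq_one hm (distBd_pos hΩ hfr hxΩ) (not_le.1 hlt).le, one_mul, sub_self]

/-- The bound, relative to the oscillation near the boundary, for the norm of the truncations. -/
def truncConst (n : ℕ) (ε : ℝ) : ℝ := 3 * (1 + (8 * n + 4) * (1 + 2 * stepConst n ε + 2 ^ n))

lemma truncConst_pos (n : ℕ) (ε : ℝ) : 0 < truncConst n ε := by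
  have := stepConst_pos n ε
  unfold truncConst
  positivity

lemma IsEpsDeltaDomain.exists_approx {ε δ : ℝ} (hn : 0 < n) (hε : 0 < ε) (hε1 : ε ≤ 1)
    (hδ : 0 < δ) (hΩ : IsRealDomain Ω) (hed : IsEpsDeltaDomain Ω ε δ)
    (hf : MemBmo Ω (lamED n ε δ) f) (hv : VanishAtBoundary Ω (lamED n ε δ) f) {η : ℝ}
    (hη : 0 < η) : ∃ F, (MemBmo Ω (lamED n ε δ) F ∧ SuppAway Ω F) ∧
      bmoNorm Ω (lamED n ε δ) (f - F) ≤ truncConst n ε * η := by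
  have hfr := hed.frontier_nonempty hn hε hδ hΩ
  have hκ := stepConst_pos n ε
  obtain ⟨t, ht, htl, hosc⟩ := hv.exists_osc_le (lamED_pos hn hε hδ) hΩ.1 hfr hf hη
  obtain ⟨B, hB, hW⟩ := hed.exists_abs_centerMean_le hn hε hε1 hδ hΩ hfr hf ht hη.le hosc
  obtain ⟨j, hj⟩ := exists_pow_lt_of_lt_one (show 0 < t / 16 by positivity)
    (by norm_num : (1 / 2 : ℝ) < 1)
  obtain ⟨k, hk⟩ := exists_nat_gt (B / η)
  set m := j + k + 1 with hm
  have hm0 : 0 < m := Nat.succ_pos _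
  have hm1 : (1 : ℝ) ≤ m := by exact_mod_cast hm0
  have hmt : (1 / 2 : ℝ) ^ m ≤ t / 16 :=
    (pow_le_pow_of_le_one (by norm_num) (by norm_num) (by omega)).trans hj.le
  have hBm : B ≤ m * η := by
    rw [div_lt_iff₀ hη] at hk
    have : (k : ℝ) ≤ m := by exact_mod_cast (by omega : k ≤ m)
    nlinarith
  set K := truncConst n ε / 3 * η with hKdef
  have hK : 0 < K := by have := truncConst_pos n ε; positivity
  have hKle : η + (8 * n + 4) / m * (B + (2 * m : ℕ) * (stepConst n ε * η) + 2 ^ n * η) ≤ K := by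
    have h1 : B + (2 * m : ℕ) * (stepConst n ε * η) + 2 ^ n * η ≤
        m * ((1 + 2 * stepConst n ε + 2 ^ n) * η) := by
      push_cast
      have : 2 ^ n * η ≤ m * (2 ^ n * η) := le_mul_of_one_le_left (by positivity) hm1
      linarith
    calc η + (8 * n + 4) / m * (B + (2 * m : ℕ) * (stepConst n ε * η) + 2 ^ n * η)
        ≤ η + (8 * n + 4) / m * (m * ((1 + 2 * stepConst n ε + 2 ^ n) * η)) := by gcongr
      _ = K := by rw [hKdef, truncConst]; field_simp
  set g : (Fin n → ℝ) → ℝ := fun x => cutoff Ω m x * f x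
  have hmain : ∀ Q : Cube n, Q.toSet ⊆ Ω → Q.osc g ≤ 2 * K ∧ (t / 8 ≤ Q.half → Q.avgAbs g ≤ K) :=
    fun Q hQ => osc_le_and_avgAbs_le_of_cutoff hΩ.1 hfr hf.1 ht hK.le hmt
      (fun P hP hPt ⟨y, hy, hyd⟩ =>
        (avg_abs_cutoff_mul_sub_le hn hΩ.1 hfr hf.1 hm0 hosc (hW (2 * m)) (by positivity) hmt hP hPt
          hy hyd).trans hKle) hQ
  have hbig : ∀ Q : Cube n, Q.toSet ⊆ Ω → lamED n ε δ ≤ Q.side → Q.avgAbs g ≤ K :=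
    fun Q hQ hs => (hmain Q hQ).2 (by rw [Cube.side] at hs; linarith)
  have hgmem : MemBmo Ω (lamED n ε δ) g :=
    .of_le (fun Q hQ => integrableOn_cutoff_mul Ω m (hf.1 Q hQ)) (fun Q hQ _ => (hmain Q hQ).1) hbig
  refine ⟨Ω.indicator (f - g), ⟨(hf.sub hgmem).congr fun x hx => (Set.indicator_of_mem hx _).symm,
    suppAway_indicator_sub_cutoff hΩ.1 hfr hm0⟩, ?_⟩
  have h1 : bmoNorm Ω (lamED n ε δ) (f - Ω.indicator (f - g)) ≤ bmoNorm Ω (lamED n ε δ) g :=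
    bmoNorm_le_of_eqOn hgmem subset_rfl fun x hx => by
      rw [Pi.sub_apply, Set.indicator_of_mem hx, Pi.sub_apply, sub_sub_cancel]
  have h2 := bmoNorm_le (by positivity) hK.le (fun Q hQ _ => (hmain Q hQ).1) hbig
  linarith

end Approximation

/-- On an (ε,δ)-domain with λ = λ_{ε,δ}: f ∈ bmo_λ(Ω) is a bmo_λ(Ω)-limit of functions
supported away from ∂Ω iff f vanishes at the boundary. -/
theorem stmt14 {n : ℕ} (hn : 0 < n) (ε δ : ℝ) (hε : 0 < ε) (hε1 : ε ≤ 1) (hδ : 0 < δ)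
    (Ω : Set (Fin n → ℝ)) (hΩ : IsRealDomain Ω) (hed : IsEpsDeltaDomain Ω ε δ)
    (f : (Fin n → ℝ) → ℝ) (hf : MemBmo Ω (lamED n ε δ) f) :
    (∃ F : ℕ → (Fin n → ℝ) → ℝ,
        (∀ j, MemBmo Ω (lamED n ε δ) (F j) ∧ SuppAway Ω (F j)) ∧
        Tendsto (fun j => bmoNorm Ω (lamED n ε δ) (f - F j)) atTop (nhds 0)) ↔
      VanishAtBoundary Ω (lamED n ε δ) f := by
  constructor
  · rintro ⟨F, hF, hlim⟩
    exact vanishAtBoundary_of_approx (hed.frontier_nonempty hn hε hδ hΩ) hf hF hlim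
  · intro hv
    choose F hF hle using fun j : ℕ =>
      hed.exists_approx hn hε hε1 hδ hΩ hf hv (Nat.one_div_pos_of_nat (n := j) (α := ℝ))
    refine ⟨F, hF, squeeze_zero (fun _ => bmoNorm_nonneg _ _ _) hle ?_⟩
    simpa using tendsto_one_div_add_atTop_nhds_zero_nat.const_mul (truncConst n ε)
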